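/- arXiv:2202.04481 — 3 statements merged into one kernel-verified Lean document; each statement's English description precedes it below -/
import Mathlib

section
/- Let A = B = {0,1} with distortion measure ρ(0,0) = ρ(1,1) = 0 and ρ(0,1) = ρ(1,0) = ρ_max > 0, and let d ∈ (0, ρ_max/2). Then liminf_{n→∞} √n · sup_{p ∈ P(A)} inf_{(φ_n,f_n,g_n) prefix d-semifaithful} [ (ln 2 / n)·E_p[ l(f_n(φ_n(X^n))) ] − R(p,d,ρ) ] > 0, and the same statement holds with the infimum taken over all (not necessarily prefix) d-semifaithful codes. In particular, even with the code optimized for the known source, the worst-case redundancy over source distributions is Ω(1/√n). -/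
open Filter MeasureTheory
open scoped BigOperators

noncomputable section

variable {A B : Type*}

/-- `p` is a probability distribution on the finite alphabet `A`. -/
def IsProb [Fintype A] (p : A → ℝ) : Prop :=
  (∀ a, 0 ≤ p a) ∧ ∑ a, p a = 1

/-- `Q` is a conditional probability distribution from `A` to `B`. -/
def IsCondProb [Fintype A] [Fintype B] (Q : A → B → ℝ) : Prop :=
  ∀ j, IsProb (Q j)

/-- `ρ` is a distortion measure in the class `D`: bounded in `[0, ρmax]` and
with `max_j min_k ρ(j,k) = 0` (equivalently, every row contains a zero). -/
def IsDistMeasure [Fintype A] [Fintype B] (ρmax : ℝ) (ρ : A → B → ℝ) : Prop :=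
  (∀ j k, 0 ≤ ρ j k ∧ ρ j k ≤ ρmax) ∧ ∀ j, ∃ k, ρ j k = 0

/-- Mutual information `I(p, Q)` in nats. -/
def mutualInfo [Fintype A] [Fintype B] (p : A → ℝ) (Q : A → B → ℝ) : ℝ :=
  ∑ j, ∑ k, p j * Q j k * Real.log (Q j k / ∑ j', p j' * Q j' k)

/-- Average distortion `Σ_{j,k} p(j) Q(k|j) ρ(j,k)`. -/
def avgDist [Fintype A] [Fintype B] (p : A → ℝ) (Q : A → B → ℝ) (ρ : A → B → ℝ) : ℝ :=
  ∑ j, ∑ k, p j * Q j k * ρ j k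

/-- The rate-distortion function `R(p,d,ρ)` in nats. -/
def RD [Fintype A] [Fintype B] (p : A → ℝ) (d : ℝ) (ρ : A → B → ℝ) : ℝ :=
  sInf { r | ∃ Q, IsCondProb Q ∧ avgDist p Q ρ ≤ d ∧ r = mutualInfo p Q }

/-- The type (empirical distribution) of a sequence `x ∈ A^n`. -/
def typeOf [DecidableEq A] {n : ℕ} (x : Fin n → A) : A → ℝ :=
  fun a => ((Finset.univ.filter fun i => x i = a).card : ℝ) / n

/-- The i.i.d. product probability `p^n(x) = ∏ i p(x_i)`. -/
def prodProb {n : ℕ} (p : A → ℝ) (x : Fin n → A) : ℝ :=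
  ∏ i, p (x i)

/-- The `n`-fold single-letter distortion `ρ_n(x,y) = (1/n) Σ_i ρ(x_i, y_i)`. -/
def nDist {n : ℕ} (ρ : A → B → ℝ) (x : Fin n → A) (y : Fin n → B) : ℝ :=
  (∑ i, ρ (x i) (y i)) / n

/-- `E_p[R(T,d,ρ)]`, the expectation of the empirical rate-distortion function
over `X^n` i.i.d. `p` (written as a sum over sequences). -/
def expTypeRD [Fintype A] [DecidableEq A] [Fintype B] (n : ℕ) (p : A → ℝ)
    (d : ℝ) (ρ : A → B → ℝ) : ℝ :=
  ∑ x : Fin n → A, prodProb p x * RD (typeOf x) d ρ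

/-- The binary Hamming-type distortion measure with off-diagonal value `ρmax`. -/
def binDist (ρmax : ℝ) : Fin 2 → Fin 2 → ℝ :=
  fun j k => if j = k then 0 else ρmax

/-- The max-min redundancy at blocklength `n` for the binary Hamming case:
`sup_{p} inf_{codes} [(ln 2/n) E_p[l(f(φ(X^n)))] − R(p,d,ρ)]`, where the infimum is
over `d`-semifaithful codes; `pre = true` restricts to prefix codes. -/
def maxMinRedundancy (ρmax d : ℝ) (pre : Bool) (n : ℕ) : ℝ :=
  sSup { v : ℝ | ∃ p : Fin 2 → ℝ, IsProb p ∧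
    v = sInf { r : ℝ |
      ∃ (φ : (Fin n → Fin 2) → (Fin n → Fin 2))
        (f : (Fin n → Fin 2) → List Bool)
        (g : List Bool → (Fin n → Fin 2)),
        (∀ x, nDist (binDist ρmax) x (φ x) ≤ d) ∧
        (∀ x, g (f (φ x)) = φ x) ∧
        (pre = true → ∀ x₁ x₂, f (φ x₁) <+: f (φ x₂) → f (φ x₁) = f (φ x₂)) ∧
        r = (Real.log 2 / n) *
              (∑ x : Fin n → Fin 2, prodProb p x * ((f (φ x)).length : ℝ))
            - RD p d (binDist ρmax) } }


/-! ### Product expectations -/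

/-- Expectation under a product of (possibly different) weights. -/
def EE {n : ℕ} (q : Fin n → Fin 2 → ℝ) (F : (Fin n → Fin 2) → ℝ) : ℝ :=
  ∑ x : Fin n → Fin 2, (∏ i, q i (x i)) * F x

lemma EE_add {n : ℕ} (q : Fin n → Fin 2 → ℝ) (F G : (Fin n → Fin 2) → ℝ) :
    EE q (fun x => F x + G x) = EE q F + EE q G := by
  simp only [EE, mul_add, Finset.sum_add_distrib]

lemma EE_smul {n : ℕ} (q : Fin n → Fin 2 → ℝ) (c : ℝ) (F : (Fin n → Fin 2) → ℝ) :
    EE q (fun x => c * F x) = c * EE q F := by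
  simp only [EE, Finset.mul_sum]
  exact Finset.sum_congr rfl fun x _ => by ring

lemma EE_mono {n : ℕ} (q : Fin n → Fin 2 → ℝ) (hq : ∀ i a, 0 ≤ q i a)
    (F G : (Fin n → Fin 2) → ℝ) (h : ∀ x, F x ≤ G x) : EE q F ≤ EE q G := by
  refine Finset.sum_le_sum fun x _ => ?_
  exact mul_le_mul_of_nonneg_left (h x) (Finset.prod_nonneg fun i _ => hq i _)

lemma EE_prod {n : ℕ} (q : Fin n → Fin 2 → ℝ) (g : Fin n → Fin 2 → ℝ) :
    EE q (fun x => ∏ i, g i (x i)) = ∏ i, ∑ a, q i a * g i a := by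
  rw [Finset.prod_univ_sum, Fintype.piFinset_univ]
  simp only [EE, Finset.prod_mul_distrib]

lemma EE_one {n : ℕ} (q : Fin n → Fin 2 → ℝ) (hq : ∀ i, ∑ a, q i a = 1) :
    EE q (fun _ => 1) = 1 := by
  have := EE_prod q (fun _ _ => 1)
  simpa [hq] using this

lemma EE_const {n : ℕ} (q : Fin n → Fin 2 → ℝ) (hq : ∀ i, ∑ a, q i a = 1) (c : ℝ) :
    EE q (fun _ => c) = c := by
  have := EE_smul q c (fun _ => 1)
  rw [EE_one q hq] at this
  simpa using this

lemma EE_succ {n : ℕ} (q : Fin (n+1) → Fin 2 → ℝ) (F : (Fin (n+1) → Fin 2) → ℝ) :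
    EE q F = ∑ a, q 0 a * EE (fun i => q i.succ) (fun y => F (Fin.cons a y)) := by
  unfold EE
  rw [← (Fin.consEquiv (fun _ => Fin 2)).sum_comp, Fintype.sum_prod_type]
  refine Finset.sum_congr rfl fun a _ => ?_
  rw [Finset.mul_sum]
  refine Finset.sum_congr rfl fun y _ => ?_
  simp only [Fin.consEquiv, Equiv.coe_fn_mk, Fin.prod_univ_succ, Fin.cons_zero, Fin.cons_succ]
  ring

lemma EE_moments {n : ℕ} (q : Fin n → Fin 2 → ℝ) (g : Fin n → Fin 2 → ℝ)
    (hq0 : ∀ i a, 0 ≤ q i a) (hq : ∀ i, ∑ a, q i a = 1) (hg : ∀ i, ∑ a, q i a * g i a = 0)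
    (hg1 : ∀ i a, |g i a| ≤ 1) :
    EE q (fun x => ∑ i, g i (x i)) = 0 ∧
    EE q (fun x => (∑ i, g i (x i)) ^ 2) = ∑ i, ∑ a, q i a * (g i a) ^ 2 ∧
    EE q (fun x => (∑ i, g i (x i)) ^ 2) ≤ n ∧
    EE q (fun x => (∑ i, g i (x i)) ^ 4) ≤ 3 * (n : ℝ) ^ 2 := by
  induction n with
  | zero => simp [EE]
  | succ n ih =>
    obtain ⟨h1, h2, h2', h4⟩ := ih (fun i => q i.succ) (fun i => g i.succ)
      (fun i a => hq0 _ a) (fun i => hq _) (fun i => hg _) (fun i a => hg1 _ a)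
    have h0 := EE_one (fun i : Fin n => q i.succ) (fun i => hq _)
    simp only [EE_succ, Fin.sum_univ_succ (n := n), Fin.cons_zero, Fin.cons_succ]
    set Q : Fin n → Fin 2 → ℝ := fun i => q i.succ with hQ
    set S : (Fin n → Fin 2) → ℝ := fun x => ∑ i : Fin n, g i.succ (x i) with hS
    have e1 : ∀ c : ℝ, EE Q (fun y => c + S y) = c := by
      intro c
      rw [EE_add, h1, EE_const Q (fun i => hq _)]; ring
    have e2 : ∀ c : ℝ, EE Q (fun y => (c + S y) ^ 2) = c ^ 2 + EE Q (fun y => S y ^ 2) := by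
      intro c
      have : (fun y => (c + S y) ^ 2) = fun y => (c ^ 2 + (2 * c) * S y) + S y ^ 2 := by
        funext y; ring
      rw [this, EE_add, EE_add, EE_smul, h1, EE_const Q (fun i => hq _)]; ring
    have e4 : ∀ c : ℝ, EE Q (fun y => (c + S y) ^ 4) = c ^ 4 + 6 * c ^ 2 * EE Q (fun y => S y ^ 2)
        + 4 * c * EE Q (fun y => S y ^ 3) + EE Q (fun y => S y ^ 4) := by
      intro c
      have : (fun y => (c + S y) ^ 4) = fun y => (((c ^ 4 + (4 * c ^ 3) * S y) +
          (6 * c ^ 2) * S y ^ 2) + (4 * c) * S y ^ 3) + S y ^ 4 := by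
        funext y; ring
      rw [this, EE_add, EE_add, EE_add, EE_add, EE_smul, EE_smul, EE_smul, h1,
        EE_const Q (fun i => hq _)]; ring
    simp only [hS] at e1 e2 e4
    simp only [e1, e2, e4, h2]
    have q0 := hq 0
    have g0 := hg 0
    have a0 := hq0 0 0
    have a1 := hq0 0 1
    have b0 := sq_le_one_iff_abs_le_one _ |>.2 (hg1 0 0)
    have b1 := sq_le_one_iff_abs_le_one _ |>.2 (hg1 0 1)
    rw [h2] at h2'
    have hv0 : 0 ≤ ∑ i : Fin n, ∑ a, Q i a * (g i.succ a) ^ 2 :=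
      Finset.sum_nonneg fun i _ => Finset.sum_nonneg fun a _ => mul_nonneg (hq0 _ _) (sq_nonneg _)
    set V := ∑ i : Fin n, ∑ a, Q i a * (g i.succ a) ^ 2
    simp only [Fin.sum_univ_two] at q0 g0 ⊢
    set E3 := EE Q (fun y => (∑ i : Fin n, g i.succ (y i)) ^ 3)
    set E4 := EE Q (fun y => (∑ i : Fin n, g i.succ (y i)) ^ 4)
    have hv : q 0 0 * g 0 0 ^ 2 + q 0 1 * g 0 1 ^ 2 ≤ 1 := by nlinarith
    have hv' : 0 ≤ q 0 0 * g 0 0 ^ 2 + q 0 1 * g 0 1 ^ 2 := by positivity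
    have c0 : g 0 0 ^ 4 ≤ 1 := by nlinarith [sq_nonneg (g 0 0)]
    have c1 : g 0 1 ^ 4 ≤ 1 := by nlinarith [sq_nonneg (g 0 1)]
    have hw : q 0 0 * g 0 0 ^ 4 + q 0 1 * g 0 1 ^ 4 ≤ 1 := by nlinarith
    have hn : (0:ℝ) ≤ n := Nat.cast_nonneg n
    refine ⟨by linarith, ?_, ?_, ?_⟩
    · linear_combination V * q0
    · push_cast
      have : q 0 0 * (g 0 0 ^ 2 + V) + q 0 1 * (g 0 1 ^ 2 + V) =
        (q 0 0 * g 0 0 ^ 2 + q 0 1 * g 0 1 ^ 2) + V := by linear_combination V * q0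
      linarith
    · push_cast
      have : q 0 0 * (g 0 0 ^ 4 + 6 * g 0 0 ^ 2 * V + 4 * g 0 0 * E3 + E4) +
        q 0 1 * (g 0 1 ^ 4 + 6 * g 0 1 ^ 2 * V + 4 * g 0 1 * E3 + E4) =
        (q 0 0 * g 0 0 ^ 4 + q 0 1 * g 0 1 ^ 4) + 6 * (q 0 0 * g 0 0 ^ 2 + q 0 1 * g 0 1 ^ 2) * V
        + E4 := by linear_combination E4 * q0 + 4 * E3 * g0
      rw [this]
      have : (q 0 0 * g 0 0 ^ 2 + q 0 1 * g 0 1 ^ 2) * V ≤ 1 * n :=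
        mul_le_mul hv h2' hv0 (by norm_num)
      nlinarith

lemma EE_abs_upper {n : ℕ} (hn : 0 < n) (q : Fin n → Fin 2 → ℝ) (g : Fin n → Fin 2 → ℝ)
    (hq0 : ∀ i a, 0 ≤ q i a) (hq : ∀ i, ∑ a, q i a = 1) (hg : ∀ i, ∑ a, q i a * g i a = 0)
    (hg1 : ∀ i a, |g i a| ≤ 1) :
    EE q (fun x => |∑ i, g i (x i)|) ≤ √n := by
  obtain ⟨h1, h2, h2', h4⟩ := EE_moments q g hq0 hq hg hg1
  have hs : 0 < √(n:ℝ) := Real.sqrt_pos.2 (by exact_mod_cast hn)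
  have hss : √(n:ℝ) * √n = n := Real.mul_self_sqrt (by positivity)
  have : EE q (fun x => |∑ i, g i (x i)|) ≤
      EE q (fun x => √n / 2 + (1 / (2 * √n)) * (∑ i, g i (x i)) ^ 2) := by
    refine EE_mono q hq0 _ _ fun x => ?_
    set z := ∑ i, g i (x i)
    rw [← sq_abs z, ← sub_nonneg]
    have : √n / 2 + (1 / (2 * √n)) * |z| ^ 2 - |z| = (√n - |z|)^2 / (2 * √n) := by
      field_simp; ring
    rw [this]; positivity
  refine this.trans ?_
  rw [EE_add, EE_smul, EE_const q hq]
  have : 1 / (2 * √n) * EE q (fun x => (∑ i, g i (x i)) ^ 2) ≤ 1 / (2 * √n) * n :=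
    mul_le_mul_of_nonneg_left h2' (by positivity)
  refine (add_le_add_right this _).trans (le_of_eq ?_)
  nth_rewrite 3 [← hss]
  field_simp; norm_num

/-- Lower bound on the mean absolute deviation. -/
lemma EE_abs_lower {n : ℕ} (q : Fin n → Fin 2 → ℝ) (g : Fin n → Fin 2 → ℝ)
    (hq0 : ∀ i a, 0 ≤ q i a) (hq : ∀ i, ∑ a, q i a = 1) (hg : ∀ i, ∑ a, q i a * g i a = 0)
    (hg1 : ∀ i a, |g i a| ≤ 1) (v : ℝ) (hv : 0 < v) (hvg : ∀ i, ∑ a, q i a * (g i a) ^ 2 = v) :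
    v / (2 * √(6 / v)) * √n ≤ EE q (fun x => |∑ i, g i (x i)|) := by
  rcases Nat.eq_zero_or_pos n with rfl | hn
  · simp [EE]
  obtain ⟨h1, h2, h2', h4⟩ := EE_moments q g hq0 hq hg hg1
  have hs : 0 < √(n:ℝ) := Real.sqrt_pos.2 (by exact_mod_cast hn)
  have hss : √(n:ℝ) ^ 2 = n := Real.sq_sqrt (by positivity)
  have hk : 0 < √(6 / v) := Real.sqrt_pos.2 (by positivity)
  have hkk : √(6 / v) ^ 2 = 6 / v := Real.sq_sqrt (by positivity)
  set κ := √(6 / v)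
  set K := κ * √n with hK
  have hKpos : 0 < K := by positivity
  have : EE q (fun x => (∑ i, g i (x i)) ^ 2) ≤
      EE q (fun x => K * |∑ i, g i (x i)| + (1 / K ^ 2) * (∑ i, g i (x i)) ^ 4) := by
    refine EE_mono q hq0 _ _ fun x => ?_
    set z := ∑ i, g i (x i)
    have hz4 : z ^ 4 = |z| ^ 4 := by rw [pow_abs, abs_of_nonneg]; positivity
    rw [← sq_abs z, hz4]
    have ha := abs_nonneg z
    rcases le_total (|z|) K with h | h
    · have : |z| ^ 2 ≤ K * |z| := by nlinarith
      have : 0 ≤ 1 / K ^ 2 * |z| ^ 4 := by positivity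
      linarith
    · have : |z| ^ 2 ≤ 1 / K ^ 2 * |z| ^ 4 := by
        rw [one_div, inv_mul_eq_div, le_div_iff₀ (by positivity)]
        have : K ^ 2 ≤ |z| ^ 2 := by gcongr
        nlinarith [sq_nonneg (|z|)]
      have : 0 ≤ K * |z| := by positivity
      linarith
  rw [EE_add, EE_smul, EE_smul, h2] at this
  simp only [hvg, Finset.sum_const, Finset.card_univ, Fintype.card_fin, nsmul_eq_mul] at this
  have h5 : 1 / K ^ 2 * EE q (fun x => (∑ i, g i (x i)) ^ 4) ≤ n * v / 2 := by
    refine (mul_le_mul_of_nonneg_left h4 (by positivity)).trans (le_of_eq ?_)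
    rw [hK, mul_pow, hkk, hss]
    field_simp; norm_num
  have h6 : n * v / 2 ≤ K * EE q (fun x => |∑ i, g i (x i)|) := by linarith
  have h7 : K * (v / (2 * κ) * √n) = n * v / 2 := by
    have h8 : K * (v / (2 * κ) * √n) = √(n:ℝ) ^ 2 * v / 2 := by rw [hK]; field_simp
    rw [h8, hss]
  rw [← h7] at h6
  exact le_of_mul_le_mul_left h6 hKpos

/-! ### Combinatorial lemmas -/

lemma kraft_four (S : Finset (List Bool)) : ∑ s ∈ S, (1/4 : ℝ) ^ s.length ≤ 2 := by
  classical
  set M := S.sup List.length + 1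
  have hmaps : ∀ s ∈ S, s.length ∈ Finset.range M := fun s hs => by
    have := Finset.le_sup (f := List.length) hs
    simp only [Finset.mem_range]; omega
  rw [← Finset.sum_fiberwise_of_maps_to hmaps]
  have hcard : ∀ m, (S.filter fun s => s.length = m).card ≤ 2 ^ m := by
    intro m
    have : (S.filter fun s => s.length = m) ⊆
        (Finset.univ : Finset (Fin m → Bool)).image List.ofFn := by
      intro s hs
      obtain ⟨-, rfl⟩ := Finset.mem_filter.1 hs
      exact Finset.mem_image.2 ⟨s.get, Finset.mem_univ _, List.ofFn_get s⟩
    refine (Finset.card_le_card this).trans (Finset.card_image_le.trans ?_)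
    simp
  have : ∀ m ∈ Finset.range M, ∑ s ∈ S.filter (fun s => s.length = m), (1/4 : ℝ) ^ s.length
      ≤ (1/2 : ℝ) ^ m := by
    intro m _
    rw [Finset.sum_congr rfl (g := fun _ => (1/4 : ℝ) ^ m)
      (fun s hs => by rw [(Finset.mem_filter.1 hs).2])]
    rw [Finset.sum_const, nsmul_eq_mul]
    have h1 : ((S.filter fun s => s.length = m).card : ℝ) ≤ 2 ^ m := by exact_mod_cast hcard m
    calc _ ≤ (2:ℝ) ^ m * (1/4) ^ m := by gcongr
      _ = (1/2) ^ m := by rw [← mul_pow]; norm_num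
  refine (Finset.sum_le_sum this).trans ?_
  have := sum_geometric_two_le M
  simpa using this

/-- Greedy covering. -/
lemma greedy_cover {X Y : Type*} [Fintype Y] [DecidableEq X] [DecidableEq Y]
    (μ : Y → ℝ) (hμ0 : ∀ y, 0 ≤ μ y) (hμ : ∑ y, μ y = 1) (R : X → Y → Prop)
    [∀ x y, Decidable (R x y)] (T : Finset X) (q : ℝ) (hq1 : q ≤ 1)
    (hq : ∀ x ∈ T, q ≤ ∑ y, if R x y then μ y else 0) (N : ℕ) :
    ∃ C : Finset Y, C.card ≤ N ∧
      ((T.filter fun x => ∀ y ∈ C, ¬ R x y).card : ℝ) ≤ (1 - q) ^ N * T.card := by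
  induction N with
  | zero => exact ⟨∅, by simp, by simp⟩
  | succ N ih =>
    obtain ⟨C, hC, hU⟩ := ih
    set U := T.filter fun x => ∀ y ∈ C, ¬ R x y with hUdef
    have hsum : q * U.card ≤ ∑ y, μ y * ((U.filter fun x => R x y).card : ℝ) := by
      calc q * U.card = ∑ x ∈ U, q := by rw [Finset.sum_const, nsmul_eq_mul, mul_comm]
        _ ≤ ∑ x ∈ U, ∑ y, if R x y then μ y else 0 :=
            Finset.sum_le_sum fun x hx => hq x (Finset.mem_filter.1 hx).1
        _ = ∑ y, ∑ x ∈ U, if R x y then μ y else 0 := Finset.sum_comm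
        _ = _ := by
            refine Finset.sum_congr rfl fun y _ => ?_
            rw [← Finset.sum_filter, Finset.sum_const, nsmul_eq_mul, mul_comm]
    have : ∃ y, q * U.card ≤ ((U.filter fun x => R x y).card : ℝ) := by
      by_contra! hcon
      have hne : ∃ y, 0 < μ y := by
        by_contra! h
        have : ∑ y, μ y ≤ 0 := Finset.sum_nonpos fun y _ => h y
        linarith
      obtain ⟨y0, hy0⟩ := hne
      have : ∑ y, μ y * ((U.filter fun x => R x y).card : ℝ) < ∑ y, μ y * (q * U.card) :=
        Finset.sum_lt_sum (fun y _ => mul_le_mul_of_nonneg_left (hcon y).le (hμ0 y))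
          ⟨y0, Finset.mem_univ _, mul_lt_mul_of_pos_left (hcon y0) hy0⟩
      rw [← Finset.sum_mul, hμ, one_mul] at this
      linarith
    obtain ⟨y, hy⟩ := this
    refine ⟨insert y C, (Finset.card_insert_le _ _).trans (by omega), ?_⟩
    have heq : (T.filter fun x => ∀ z ∈ insert y C, ¬ R x z) = U.filter fun x => ¬ R x y := by
      ext x
      simp only [hUdef, Finset.mem_filter, Finset.mem_insert, forall_eq_or_imp]
      tauto
    rw [heq]
    have hsplit := Finset.card_filter_add_card_filter_not (s := U) (fun x => R x y)
    have hsplit' : ((U.filter fun x => R x y).card : ℝ) + ((U.filter fun x => ¬ R x y).card : ℝ)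
      = U.card := by exact_mod_cast hsplit
    have : (1 - q) * (U.card : ℝ) ≤ (1 - q) * ((1 - q) ^ N * T.card) :=
      mul_le_mul_of_nonneg_left hU (by linarith)
    rw [pow_succ]
    linarith

/-- A two-part prefix code from class codebooks. -/
lemma two_part_code {X Y : Type*} [DecidableEq Y] [Nonempty Y] (M w : ℕ) (hM : M ≤ 2 ^ w)
    (k : X → Fin M) (C : Fin M → Finset Y) (L : Fin M → ℕ) (hC : ∀ j, (C j).card ≤ 2 ^ (L j))
    (R : X → Y → Prop) (hR : ∀ x, ∃ y ∈ C (k x), R x y) :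
    ∃ (φ : X → Y) (f : Y → List Bool) (g : List Bool → Y),
      (∀ x, R x (φ x)) ∧ (∀ x, g (f (φ x)) = φ x) ∧
      (∀ x₁ x₂, f (φ x₁) <+: f (φ x₂) → f (φ x₁) = f (φ x₂)) ∧
      (∀ x, (f (φ x)).length ≤ w + L (k x)) := by
  classical
  choose φ hφC hφR using hR
  have he : ∀ j, ∃ e : Y → (Fin (L j) → Bool), Set.InjOn e (C j) := by
    intro j
    have : Fintype.card (C j) ≤ Fintype.card (Fin (L j) → Bool) := by
      simpa using hC j
    obtain ⟨e⟩ := Function.Embedding.nonempty_of_card_le this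
    refine ⟨fun y => if h : y ∈ C j then e ⟨y, h⟩ else fun _ => false, ?_⟩
    intro y hy y' hy' hyy
    have hy1 : y ∈ C j := hy
    have hy2 : y' ∈ C j := hy'
    simp only [hy1, hy2, dif_pos] at hyy
    simpa using e.injective hyy
  choose e he using he
  have hb : ∃ b : Fin M → (Fin w → Bool), Function.Injective b := by
    have : Fintype.card (Fin M) ≤ Fintype.card (Fin w → Bool) := by simpa using hM
    obtain ⟨b⟩ := Function.Embedding.nonempty_of_card_le this
    exact ⟨b, b.injective⟩
  obtain ⟨b, hb⟩ := hb
  by_cases hX : Nonempty X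
  swap
  · rw [not_nonempty_iff] at hX
    exact ⟨φ, fun _ => [], fun _ => Classical.arbitrary Y, fun x => isEmptyElim x,
      fun x => isEmptyElim x, fun x => isEmptyElim x, fun x => isEmptyElim x⟩
  obtain ⟨x0⟩ := hX
  have : Nonempty (Fin M) := ⟨k x0⟩
  have hm : ∀ y, (∃ j, y ∈ C j) → ∃ j, y ∈ C j ∧ ∀ j', y ∈ C j' → L j ≤ L j' := by
    intro y ⟨j, hj⟩
    obtain ⟨j0, h0, h1⟩ := Finset.exists_min_image (Finset.univ.filter fun j => y ∈ C j) L
      ⟨j, by simpa using hj⟩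
    exact ⟨j0, by simpa using h0, fun j' hj' => h1 j' (by simpa using hj')⟩
  choose! m hm1 hm2 using hm
  set f : Y → List Bool := fun y => List.ofFn (b (m y)) ++ List.ofFn (e (m y) y) with hf
  have hpre : ∀ x₁ x₂, f (φ x₁) <+: f (φ x₂) → φ x₁ = φ x₂ := by
    intro x₁ x₂ h
    simp only [hf] at h
    have h1 : List.ofFn (b (m (φ x₁))) = List.ofFn (b (m (φ x₂))) := by
      have ha : List.ofFn (b (m (φ x₁))) <+:
        List.ofFn (b (m (φ x₂))) ++ List.ofFn (e (m (φ x₂)) (φ x₂)) :=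
        (List.prefix_append _ _).trans h
      have hb' := List.prefix_append (List.ofFn (b (m (φ x₂)))) (List.ofFn (e (m (φ x₂)) (φ x₂)))
      exact (List.prefix_of_prefix_length_le ha hb' (by simp)).eq_of_length (by simp)
    have h2 : m (φ x₁) = m (φ x₂) := hb (List.ofFn_injective h1)
    rw [h1, List.prefix_append_right_inj] at h
    have hm1' := hm1 (φ x₁) ⟨_, hφC x₁⟩
    have hm2' := hm1 (φ x₂) ⟨_, hφC x₂⟩
    rw [← h2] at h hm2'
    have h3 := h.eq_of_length (by simp)
    exact he _ hm1' hm2' (List.ofFn_injective h3)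
  refine ⟨φ, f, fun s => if h : ∃ x, f (φ x) = s then φ h.choose else φ x0, hφR, ?_, ?_, ?_⟩
  · intro x
    have h : ∃ x', f (φ x') = f (φ x) := ⟨x, rfl⟩
    simp only [dif_pos h]
    exact hpre _ _ (by rw [h.choose_spec])
  · intro x₁ x₂ h
    rw [hpre _ _ h]
  · intro x
    simp only [hf, List.length_append, List.length_ofFn]
    have := hm2 (φ x) ⟨_, hφC x⟩ _ (hφC x)
    omega

/-! ### Rate-distortion function lower bounds -/

/-- Binary entropy in nats. -/
def Hb (u : ℝ) : ℝ := -(u * Real.log u + (1 - u) * Real.log (1 - u))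

lemma mul_log_gibbs (u v : ℝ) (hu : 0 ≤ u) (hv : 0 < v) :
    -(u * Real.log u) ≤ -(u * Real.log v) + (v - u) := by
  rcases hu.eq_or_lt with rfl | hu
  · simp; exact hv.le
  · have h := Real.log_le_sub_one_of_pos (show 0 < v / u by positivity)
    rw [Real.log_div hv.ne' hu.ne'] at h
    have h2 := mul_le_mul_of_nonneg_left h hu.le
    have h3 : u * (v / u - 1) = v - u := by field_simp
    rw [h3] at h2
    linarith

lemma Hb_gibbs (u v : ℝ) (hu : 0 ≤ u) (hu1 : u ≤ 1) (hv : 0 < v) (hv1 : v < 1) :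
    Hb u ≤ -(u * Real.log v + (1 - u) * Real.log (1 - v)) := by
  have h1 := mul_log_gibbs u v hu hv
  have h2 := mul_log_gibbs (1 - u) (1 - v) (by linarith) (by linarith)
  unfold Hb
  linarith

lemma rd_term (a Q q V : ℝ) (ha : 0 ≤ a) (hQ : 0 ≤ Q) (hq : a * Q ≤ q) (hV : 0 < V) :
    a * Q * Real.log (V / a) + a * Q - q * V ≤ a * Q * Real.log (Q / q) := by
  have hq0 : 0 ≤ q := (mul_nonneg ha hQ).trans hq
  rcases (mul_nonneg ha hQ).eq_or_lt with h | h
  · rw [← h]; simp; positivity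
  · have ha' : 0 < a := pos_of_mul_pos_left h hQ
    have hQ' : 0 < Q := pos_of_mul_pos_right h ha
    have hq' : 0 < q := h.trans_le hq
    have hl := Real.log_le_sub_one_of_pos (show 0 < (q * V) / (a * Q) by positivity)
    rw [Real.log_div (by positivity) (by positivity), Real.log_mul hq'.ne' hV.ne',
      Real.log_mul ha'.ne' hQ'.ne'] at hl
    rw [Real.log_div hV.ne' ha'.ne', Real.log_div hQ'.ne' hq'.ne']
    have h2 := mul_le_mul_of_nonneg_left hl h.le
    have h3 : a * Q * (q * V / (a * Q) - 1) = q * V - a * Q := by field_simp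
    rw [h3] at h2
    linarith

lemma rd_term0 (a Q q : ℝ) (ha : 0 ≤ a) (hQ : 0 ≤ Q) (hq : a * Q ≤ q) :
    a * Q - q * a ≤ a * Q * Real.log (Q / q) := by
  rcases ha.eq_or_lt with rfl | h
  · simp
  · have := rd_term a Q q a ha hQ hq h
    rw [div_self h.ne', Real.log_one] at this
    linarith

lemma mutualInfo_nonneg (p : Fin 2 → ℝ) (hp : IsProb p) (Q : Fin 2 → Fin 2 → ℝ)
    (hQ : IsCondProb Q) : 0 ≤ mutualInfo p Q := by
  obtain ⟨hp0, hp1⟩ := hp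
  have hQ0 : ∀ j k, 0 ≤ Q j k := fun j => (hQ j).1
  have r0 := (hQ 0).2
  have r1 := (hQ 1).2
  simp only [Fin.sum_univ_two] at hp1 r0 r1
  simp only [mutualInfo, Fin.sum_univ_two]
  have m0 := fun j k => mul_nonneg (hp0 j) (hQ0 j k)
  have t00 := rd_term0 (p 0) (Q 0 0) (p 0 * Q 0 0 + p 1 * Q 1 0) (hp0 0) (hQ0 0 0)
    (by linarith [m0 1 0])
  have t01 := rd_term0 (p 0) (Q 0 1) (p 0 * Q 0 1 + p 1 * Q 1 1) (hp0 0) (hQ0 0 1)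
    (by linarith [m0 1 1])
  have t10 := rd_term0 (p 1) (Q 1 0) (p 0 * Q 0 0 + p 1 * Q 1 0) (hp0 1) (hQ0 1 0)
    (by linarith [m0 0 0])
  have t11 := rd_term0 (p 1) (Q 1 1) (p 0 * Q 0 1 + p 1 * Q 1 1) (hp0 1) (hQ0 1 1)
    (by linarith [m0 0 1])
  have : p 0 = 1 - p 1 := by linarith
  have e0 : Q 0 1 = 1 - Q 0 0 := by linarith
  have e1 : Q 1 1 = 1 - Q 1 0 := by linarith
  have : p 0 * Q 0 0 - (p 0 * Q 0 0 + p 1 * Q 1 0) * p 0 +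
    (p 0 * Q 0 1 - (p 0 * Q 0 1 + p 1 * Q 1 1) * p 0) +
    (p 1 * Q 1 0 - (p 0 * Q 0 0 + p 1 * Q 1 0) * p 1) +
    (p 1 * Q 1 1 - (p 0 * Q 0 1 + p 1 * Q 1 1) * p 1) = 0 := by
    rw [e0, e1, this]; ring
  linarith

lemma mutualInfo_ge (p : Fin 2 → ℝ) (hp : IsProb p) (Q : Fin 2 → Fin 2 → ℝ)
    (hQ : IsCondProb Q) (δ : ℝ) (hδ : 0 < δ) (hδ2 : δ < 1 / 2)
    (hpos : ∀ a, 0 < p a) (hd : p 0 * Q 0 1 + p 1 * Q 1 0 ≤ δ) :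
    Hb (p 1) - Hb δ ≤ mutualInfo p Q := by
  obtain ⟨hp0, hp1⟩ := hp
  have hQ0 : ∀ j k, 0 ≤ Q j k := fun j => (hQ j).1
  have r0 := (hQ 0).2
  have r1 := (hQ 1).2
  simp only [Fin.sum_univ_two] at hp1 r0 r1
  simp only [mutualInfo, Fin.sum_univ_two]
  have m0 := fun j k => mul_nonneg (hp0 j) (hQ0 j k)
  have hδ1 : 0 < 1 - δ := by linarith
  have t00 := rd_term (p 0) (Q 0 0) (p 0 * Q 0 0 + p 1 * Q 1 0) (1 - δ) (hp0 0) (hQ0 0 0)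
    (by linarith [m0 1 0]) hδ1
  have t01 := rd_term (p 0) (Q 0 1) (p 0 * Q 0 1 + p 1 * Q 1 1) δ (hp0 0) (hQ0 0 1)
    (by linarith [m0 1 1]) hδ
  have t10 := rd_term (p 1) (Q 1 0) (p 0 * Q 0 0 + p 1 * Q 1 0) δ (hp0 1) (hQ0 1 0)
    (by linarith [m0 0 0]) hδ
  have t11 := rd_term (p 1) (Q 1 1) (p 0 * Q 0 1 + p 1 * Q 1 1) (1 - δ) (hp0 1) (hQ0 1 1)
    (by linarith [m0 0 1]) hδ1
  rw [Real.log_div hδ1.ne' (hpos _).ne'] at t00 t11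
  rw [Real.log_div hδ.ne' (hpos _).ne'] at t01 t10
  have hll : Real.log δ ≤ Real.log (1 - δ) := Real.log_le_log hδ (by linarith)
  have hfin : 0 ≤ (δ - (p 0 * Q 0 1 + p 1 * Q 1 0)) * (Real.log (1 - δ) - Real.log δ) :=
    mul_nonneg (by linarith) (by linarith)
  have e : 1 - p 1 = p 0 := by linarith
  unfold Hb
  rw [e]
  have e0 : Q 0 0 = 1 - Q 0 1 := by linarith
  have e1 : Q 1 1 = 1 - Q 1 0 := by linarith
  refine le_trans ?_ (add_le_add (add_le_add t00 t01) (add_le_add t10 t11))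
  rw [← sub_nonneg]
  refine le_of_le_of_eq hfin ?_
  have e2 : p 1 = 1 - p 0 := by linarith
  rw [e0, e1, e2]
  ring

lemma avgDist_bin (ρmax : ℝ) (p : Fin 2 → ℝ) (Q : Fin 2 → Fin 2 → ℝ) :
    avgDist p Q (binDist ρmax) = (p 0 * Q 0 1 + p 1 * Q 1 0) * ρmax := by
  simp [avgDist, binDist, Fin.sum_univ_two]; ring

lemma RD_set_nonempty (ρmax d : ℝ) (hd : 0 < d) (p : Fin 2 → ℝ) :
    { r | ∃ Q, IsCondProb Q ∧ avgDist p Q (binDist ρmax) ≤ d ∧ r = mutualInfo p Q }.Nonempty := by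
  refine ⟨_, fun j k => if j = k then 1 else 0, ?_, ?_, rfl⟩
  · intro j
    refine ⟨fun k => by positivity, by simp⟩
  · rw [avgDist_bin]; simp; exact hd.le

lemma RD_nonneg (ρmax d : ℝ) (hd : 0 < d) (p : Fin 2 → ℝ) (hp : IsProb p) :
    0 ≤ RD p d (binDist ρmax) := by
  refine le_csInf (RD_set_nonempty ρmax d hd p) ?_
  rintro r ⟨Q, hQ, -, rfl⟩
  exact mutualInfo_nonneg p hp Q hQ

lemma RD_ge (ρmax d : ℝ) (hρ : 0 < ρmax) (hd : 0 < d) (hd2 : d < ρmax / 2) (p : Fin 2 → ℝ)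
    (hp : IsProb p) (hpos : ∀ a, 0 < p a) :
    Hb (p 1) - Hb (d / ρmax) ≤ RD p d (binDist ρmax) := by
  refine le_csInf (RD_set_nonempty ρmax d hd p) ?_
  rintro r ⟨Q, hQ, hav, rfl⟩
  refine mutualInfo_ge p hp Q hQ _ (by positivity) ?_ hpos ?_
  · rw [div_lt_iff₀ hρ]; linarith
  · rw [avgDist_bin] at hav
    rwa [le_div_iff₀ hρ]

/-- At the critical source the rate-distortion function is (at most) zero. -/
lemma RD_crit (ρmax d : ℝ) (hρ : 0 < ρmax) (p : Fin 2 → ℝ) (hp : IsProb p)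
    (hp1 : p 1 = d / ρmax) : RD p d (binDist ρmax) ≤ 0 := by
  refine csInf_le ?_ ?_
  · refine ⟨0, ?_⟩
    rintro r ⟨Q, hQ, -, rfl⟩
    exact mutualInfo_nonneg p hp Q hQ
  · refine ⟨fun _ k => if k = 0 then 1 else 0, ?_, ?_, ?_⟩
    · intro j
      exact ⟨fun k => by positivity, by simp⟩
    · rw [avgDist_bin]; simp [hp1, hρ.ne']
    · have h2 := hp.2
      simp only [Fin.sum_univ_two] at h2
      simp [mutualInfo, Fin.sum_univ_two, h2]

lemma Hb_le_RD (ρmax d : ℝ) (hρ : 0 < ρmax) (hd : 0 < d) (hd2 : d < ρmax / 2) (p : Fin 2 → ℝ)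
    (hp : IsProb p) (u : ℝ) (hu : d / ρmax ≤ u) (hu1 : u ≤ 1 - d / ρmax) :
    Hb u - Hb (d / ρmax) ≤ RD p d (binDist ρmax) +
      (Real.log (1 - d / ρmax) - Real.log (d / ρmax)) * |u - p 1| := by
  have hδ : 0 < d / ρmax := by positivity
  have hδ2 : d / ρmax < 1 / 2 := by rw [div_lt_iff₀ hρ]; linarith
  set δ := d / ρmax with hδdef
  have hΛ : 0 ≤ Real.log (1 - δ) - Real.log δ := by
    linarith [Real.log_le_log hδ (show δ ≤ 1 - δ by linarith)]
  have hp2 := hp.2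
  simp only [Fin.sum_univ_two] at hp2
  have tangent : ∀ v, δ ≤ v → v ≤ 1 - δ →
      Hb u ≤ Hb v + (u - v) * (Real.log (1 - v) - Real.log v) := by
    intro v h1 h2
    have := Hb_gibbs u v (by linarith) (by linarith) (by linarith) (by linarith)
    unfold Hb at this ⊢
    linarith
  rcases lt_or_ge (p 1) δ with h | h
  · have h1 := tangent δ le_rfl (by linarith)
    have h2 := RD_nonneg ρmax d hd p hp
    have h3 : u - δ ≤ |u - p 1| := by linarith [le_abs_self (u - p 1)]
    nlinarith
  rcases lt_or_ge (1 - δ) (p 1) with h' | h'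
  · have h1 := tangent (1 - δ) (by linarith) le_rfl
    have h2 := RD_nonneg ρmax d hd p hp
    have h3 : (1 - δ) - u ≤ |u - p 1| := by linarith [neg_abs_le (u - p 1)]
    have h4 : Hb (1 - δ) = Hb δ := by unfold Hb; rw [sub_sub_cancel]; ring
    rw [sub_sub_cancel, h4] at h1
    nlinarith
  · have h1 := tangent (p 1) h h'
    have h2 := RD_ge ρmax d hρ hd hd2 p hp (by
      intro a; fin_cases a
      · simp; linarith
      · simp; linarith)
    rw [← hδdef] at h2
    have l1 : Real.log (1 - p 1) ≤ Real.log (1 - δ) := Real.log_le_log (by linarith) (by linarith)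
    have l2 : Real.log δ ≤ Real.log (1 - p 1) := Real.log_le_log (by linarith) (by linarith)
    have l3 : Real.log δ ≤ Real.log (p 1) := Real.log_le_log (by linarith) (by linarith)
    have l4 : Real.log (p 1) ≤ Real.log (1 - δ) := Real.log_le_log (by linarith) (by linarith)
    have h3 : |Real.log (1 - p 1) - Real.log (p 1)| ≤ Real.log (1 - δ) - Real.log δ := by
      rw [abs_le]; constructor <;> linarith
    have h5 : (u - p 1) * (Real.log (1 - p 1) - Real.log (p 1)) ≤
        (Real.log (1 - δ) - Real.log δ) * |u - p 1| := by
      refine (le_abs_self _).trans ?_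
      rw [abs_mul, mul_comm]
      exact mul_le_mul_of_nonneg_right h3 (abs_nonneg _)
    linarith

/-! ### Hamming distance and the converse -/

/-- Hamming distance as a real number. -/
def ham {n : ℕ} (x y : Fin n → Fin 2) : ℝ := ∑ i, if x i = y i then (0:ℝ) else 1

/-- Hamming weight as a real number. -/
def wt {n : ℕ} (x : Fin n → Fin 2) : ℝ := ∑ i, if x i = 1 then (1:ℝ) else 0

lemma nDist_le_iff {n : ℕ} (hn : 0 < n) (ρmax d : ℝ) (hρ : 0 < ρmax) (x y : Fin n → Fin 2) :
    nDist (binDist ρmax) x y ≤ d ↔ ham x y ≤ n * (d / ρmax) := by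
  have : ∑ i, binDist ρmax (x i) (y i) = ham x y * ρmax := by
    simp only [ham, binDist, Finset.sum_mul]
    refine Finset.sum_congr rfl fun i _ => ?_
    split_ifs <;> simp
  have hn' : (0:ℝ) < n := by exact_mod_cast hn
  rw [nDist, this, div_le_iff₀ hn', mul_div_assoc', le_div_iff₀ hρ, mul_comm d]

lemma code_lower (δ : ℝ) (hδ : 0 < δ) (hδ2 : δ < 1 / 2) {n : ℕ}
    (φ : (Fin n → Fin 2) → (Fin n → Fin 2)) (f : (Fin n → Fin 2) → List Bool)
    (g : List Bool → (Fin n → Fin 2)) (hφ : ∀ x, ham x (φ x) ≤ n * δ)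
    (hg : ∀ x, g (f (φ x)) = φ x) (p : Fin 2 → ℝ) (hp : p = ![1 - δ, δ]) :
    Real.log ((1 - δ) / δ) * (δ * (1 - δ) / (2 * √(6 / (δ * (1 - δ)))) * √n) ≤
      2 * (Real.log 4 * EE (fun _ : Fin n => p) (fun x => ((f (φ x)).length : ℝ)) + 2) := by
  classical
  have p0 : p 0 = 1 - δ := by simp [hp]
  have p1 : p 1 = δ := by simp [hp]
  set q : Fin n → Fin 2 → ℝ := fun _ => p with hqdef
  set t := Real.log ((1 - δ) / δ) with ht
  have het : Real.exp t = (1 - δ) / δ := Real.exp_log (div_pos (by linarith) hδ)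
  have hent : Real.exp (-t) = δ / (1 - δ) := by rw [Real.exp_neg, het, inv_div]
  have ht0 : 0 < t := Real.log_pos (by rw [one_lt_div hδ]; linarith)
  set G : Fin 2 → ℝ := fun a => (if a = 1 then 1 else 0) - δ with hG
  have hq0 : ∀ i a, 0 ≤ q i a := by
    intro i a; fin_cases a <;> simp [hqdef, p0, p1] <;> linarith
  have hq1 : ∀ i, ∑ a, q i a = 1 := by
    intro i; simp [hqdef, Fin.sum_univ_two, p0, p1]
  have hgm : ∀ i, ∑ a, q i a * G a = 0 := by
    intro i; simp [hqdef, hG, Fin.sum_univ_two, p0, p1]; ring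
  have hg1 : ∀ (i : Fin n) a, |G a| ≤ 1 := by
    intro i a; rw [abs_le]; fin_cases a <;> simp [hG] <;> constructor <;> linarith
  have hgv : ∀ i, ∑ a, q i a * (G a) ^ 2 = δ * (1 - δ) := by
    intro i; simp [hqdef, hG, Fin.sum_univ_two, p0, p1]; ring
  have hlow := EE_abs_lower q (fun _ => G) hq0 hq1 hgm hg1 (δ * (1 - δ))
    (mul_pos hδ (by linarith)) hgv
  obtain ⟨hmean, -⟩ := EE_moments q (fun _ => G) hq0 hq1 hgm hg1
  set Z : (Fin n → Fin 2) → ℝ := fun x => ∑ i, G (x i) with hZ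
  have hZw : ∀ x, Z x = wt x - n * δ := by
    intro x; simp [hZ, hG, wt, Finset.sum_sub_distrib]
  -- exponential moment bound
  have hball : ∀ y : Fin n → Fin 2, EE q (fun x => Real.exp (t * (wt x - ham x y))) = 1 := by
    intro y
    have : (fun x : Fin n → Fin 2 => Real.exp (t * (wt x - ham x y))) = fun x =>
        ∏ i, (fun (i : Fin n) (a : Fin 2) => Real.exp (t * ((if a = 1 then (1:ℝ) else 0) -
          (if a = y i then (0:ℝ) else 1)))) i (x i) := by
      funext x
      rw [← Real.exp_sum, ← Finset.mul_sum, Finset.sum_sub_distrib]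
      rfl
    rw [this]
    refine (EE_prod q (fun (i : Fin n) (a : Fin 2) => Real.exp (t * ((if a = 1 then (1:ℝ) else 0) -
          (if a = y i then (0:ℝ) else 1))))).trans ?_
    refine Finset.prod_eq_one fun i _ => ?_
    have hd' : 1 - δ ≠ 0 := by linarith
    generalize y i = b
    fin_cases b
    · simp [hqdef, Fin.sum_univ_two, p0, p1]
    · simp [hqdef, Fin.sum_univ_two, p0, p1, het, hent]
      field_simp; ring
  have hexp : EE q (fun x => Real.exp (t * Z x) * (1/4) ^ (f (φ x)).length) ≤ 2 := by
    unfold EE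
    rw [← Finset.sum_fiberwise_of_maps_to (s := Finset.univ) (t := Finset.univ.image φ) (g := φ)
      (fun x _ => Finset.mem_image_of_mem _ (Finset.mem_univ x))]
    have : ∀ y ∈ Finset.univ.image φ, ∑ x ∈ Finset.univ.filter (fun x => φ x = y),
        (∏ i, q i (x i)) * (Real.exp (t * Z x) * (1/4) ^ (f (φ x)).length) ≤
        (1/4 : ℝ) ^ (f y).length := by
      intro y _
      calc _ ≤ ∑ x ∈ Finset.univ.filter (fun x => φ x = y), (1/4 : ℝ) ^ (f y).length *
            ((∏ i, q i (x i)) * Real.exp (t * (wt x - ham x y))) := by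
            refine Finset.sum_le_sum fun x hx => ?_
            have hxy : φ x = y := (Finset.mem_filter.1 hx).2
            have h1 : Real.exp (t * Z x) ≤ Real.exp (t * (wt x - ham x y)) := by
              rw [Real.exp_le_exp]
              refine mul_le_mul_of_nonneg_left ?_ ht0.le
              rw [hZw, ← hxy]; linarith [hφ x]
            have h2 : 0 ≤ ∏ i, q i (x i) := Finset.prod_nonneg fun i _ => hq0 i _
            rw [hxy]
            calc _ = (1/4 : ℝ) ^ (f y).length * ((∏ i, q i (x i)) * Real.exp (t * Z x)) := by ring
              _ ≤ _ := by gcongr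
        _ ≤ ∑ x, (1/4 : ℝ) ^ (f y).length *
            ((∏ i, q i (x i)) * Real.exp (t * (wt x - ham x y))) := by
            refine Finset.sum_le_sum_of_subset_of_nonneg (Finset.filter_subset _ _) ?_
            intro x _ _
            have h2 : 0 ≤ ∏ i, q i (x i) := Finset.prod_nonneg fun i _ => hq0 i _
            positivity
        _ = _ := by
            rw [← Finset.mul_sum]
            have := hball y
            unfold EE at this
            rw [this, mul_one]
    refine (Finset.sum_le_sum this).trans ?_
    have hinj : Set.InjOn f (Finset.univ.image φ : Finset _) := by
      intro y hy y' hy' h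
      simp only [Finset.coe_image, Finset.coe_univ, Set.image_univ, Set.mem_range] at hy hy'
      obtain ⟨x, rfl⟩ := hy
      obtain ⟨x', rfl⟩ := hy'
      rw [← hg x, h, hg x']
    rw [← Finset.sum_image (f := fun s : List Bool => (1/4 : ℝ) ^ s.length) hinj]
    exact kraft_four _
  have hpt : EE q (fun x => t * |Z x|) ≤ EE q (fun x => (2 * Real.log 4) * (f (φ x)).length +
      2 * (Real.exp (t * Z x) * (1/4) ^ (f (φ x)).length) + (-t) * Z x) := by
    refine EE_mono q hq0 _ _ fun x => ?_
    set l := (f (φ x)).length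
    have hl4 : (1/4 : ℝ) ^ l = Real.exp (- (Real.log 4 * l)) := by
      rw [Real.exp_neg, mul_comm, Real.exp_nat_mul, Real.exp_log (by norm_num)]
      simp
    have hlog : 0 < Real.log 4 := Real.log_pos (by norm_num)
    rw [hl4, ← Real.exp_add]
    have h1 := Real.add_one_le_exp (t * Z x + -(Real.log 4 * l))
    have h2 := Real.exp_pos (t * Z x + -(Real.log 4 * l))
    have h3 : 0 ≤ Real.log 4 * l := by positivity
    rcases le_total 0 (Z x) with h | h
    · rw [abs_of_nonneg h]; linarith
    · rw [abs_of_nonpos h]; linarith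
  rw [EE_add, EE_add, EE_smul, EE_smul, EE_smul, EE_smul, hmean] at hpt
  have := mul_le_mul_of_nonneg_left hlow ht0.le
  linarith

/-! ### Achievability -/

lemma sum_ite_wt {n : ℕ} (x : Fin n → Fin 2) (e : Fin 2 → ℝ) :
    ∑ i, e (x i) = (n - wt x) * e 0 + wt x * e 1 := by
  have : ∀ i, e (x i) = e 0 + (if x i = 1 then (1:ℝ) else 0) * (e 1 - e 0) := by
    intro i
    generalize x i = b
    fin_cases b <;> simp
  simp only [this, Finset.sum_add_distrib, ← Finset.sum_mul, wt]
  simp; ring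

lemma ball_prob (δ δ' : ℝ) (hδ' : 0 < δ') (hδδ : δ' ≤ δ) (hδ2 : δ < 1 / 2) {n : ℕ} (hn : 0 < n)
    (hgap : n * δ' + 2 * √n = n * δ) (κ : ℝ) (hκ : δ' ≤ κ) (hκ1 : κ ≤ 1 - δ') (θ : Fin 2 → ℝ)
    (hθ : θ = ![1 - (κ - δ') / (1 - 2 * δ'), (κ - δ') / (1 - 2 * δ')])
    (x : Fin n → Fin 2) (hx : wt x = n * κ) :
    Real.exp (-(n * (Hb κ - Hb δ) + 4 * √n * (Real.log (1 - δ') - Real.log δ') + 1)) ≤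
      ∑ y : Fin n → Fin 2, if ham x y ≤ n * δ then ∏ i, θ (y i) else 0 := by
  classical
  have hn' : (0:ℝ) < n := by exact_mod_cast hn
  have hs : 0 < √(n:ℝ) := Real.sqrt_pos.2 hn'
  have hss : √(n:ℝ) ^ 2 = n := Real.sq_sqrt hn'.le
  have h12 : 0 < 1 - 2 * δ' := by linarith
  set s := (κ - δ') / (1 - 2 * δ') with hsdef
  have hs0 : 0 ≤ s := div_nonneg (by linarith) h12.le
  have hs1 : s ≤ 1 := by rw [hsdef, div_le_one h12]; linarith
  have hsk : s * (1 - 2 * δ') = κ - δ' := div_mul_cancel₀ _ h12.ne'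
  have θ0 : θ 0 = 1 - s := by simp [hθ]
  have θ1 : θ 1 = s := by simp [hθ]
  have hθnn : ∀ b, 0 ≤ θ b := by
    intro b; fin_cases b
    · simp [θ0]; exact hs1
    · simp [θ1]; exact hs0
  set P : Fin 2 → ℝ := ![1 - κ, κ] with hP
  have P0 : P 0 = 1 - κ := by simp [hP]
  have P1 : P 1 = κ := by simp [hP]
  have hκ0 : 0 < κ := by linarith
  have hκ1' : 0 < 1 - κ := by linarith
  have hPpos : ∀ a, 0 < P a := by
    intro a; fin_cases a
    · simp [P0]; linarith
    · simp [P1]; linarith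
  set V : Fin 2 → Fin 2 → ℝ := fun a b => if a = b then 1 - δ' else δ' with hV
  have hVpos : ∀ a b, 0 < V a b := by
    intro a b; simp only [hV]; split_ifs <;> linarith
  set W : Fin 2 → Fin 2 → ℝ := fun a b => θ b * V a b / P a with hW
  have hW0 : ∀ a b, 0 ≤ W a b := fun a b =>
    div_nonneg (mul_nonneg (hθnn b) (hVpos a b).le) (hPpos a).le
  have hW1 : ∀ a, ∑ b, W a b = 1 := by
    intro a
    simp only [hW, ← Finset.sum_div]
    rw [div_eq_one_iff_eq (hPpos a).ne']
    fin_cases a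
    · simp [hV, Fin.sum_univ_two, θ0, θ1, P0]; linarith
    · simp [hV, Fin.sum_univ_two, θ0, θ1, P1]; linarith
  set e : Fin 2 → ℝ := fun a => ∑ b, W a b * (if a = b then 0 else 1) with he
  have e0 : e 0 = s * δ' / (1 - κ) := by simp [he, hW, hV, Fin.sum_univ_two, θ1, P0]
  have e1 : e 1 = (1 - s) * δ' / κ := by simp [he, hW, hV, Fin.sum_univ_two, θ0, P1]
  have hesum : ∑ i, e (x i) = n * δ' := by
    rw [sum_ite_wt, hx, e0, e1]
    field_simp; ring
  have he01 : ∀ a, 0 ≤ e a ∧ e a ≤ 1 := by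
    intro a
    refine ⟨Finset.sum_nonneg fun b _ => mul_nonneg (hW0 a b) (by split_ifs <;> norm_num), ?_⟩
    rw [← hW1 a]
    refine Finset.sum_le_sum fun b _ => ?_
    exact mul_le_of_le_one_right (hW0 a b) (by split_ifs <;> norm_num)
  set q : Fin n → Fin 2 → ℝ := fun i => W (x i) with hq
  set g : Fin n → Fin 2 → ℝ := fun i b => (if x i = b then 0 else 1) - e (x i) with hg
  have hgsum : ∀ y : Fin n → Fin 2, ∑ i, g i (y i) = ham x y - n * δ' := by
    intro y
    simp only [hg, Finset.sum_sub_distrib, hesum]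
    rfl
  obtain ⟨-, -, hvar, -⟩ := EE_moments q g (fun i b => hW0 _ b) (fun i => hW1 _)
    (by
      intro i
      simp only [hg, hq, mul_sub, Finset.sum_sub_distrib, ← Finset.sum_mul, hW1]
      simp [he])
    (by
      intro i b
      have := he01 (x i)
      simp only [hg, abs_le]
      split_ifs <;> constructor <;> linarith)
  simp only [hgsum] at hvar
  set F : (Fin n → Fin 2) → ℝ := fun y => if |ham x y - n * δ'| ≤ 2 * √n then 1 else 0 with hF
  have hF34 : 3 / 4 ≤ EE q F := by
    have h1 : EE q (fun y => 1 + (-(1 / (4 * n))) * (ham x y - n * δ') ^ 2) ≤ EE q F := by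
      refine EE_mono q (fun i b => hW0 _ b) _ _ fun y => ?_
      simp only [hF]
      split_ifs with h
      · have : 0 ≤ 1 / (4 * (n:ℝ)) * (ham x y - n * δ') ^ 2 := by positivity
        linarith
      · push Not at h
        have h2 : (2 * √n) ^ 2 ≤ (ham x y - n * δ') ^ 2 := by
          rw [← sq_abs (ham x y - n * δ')]; gcongr
        rw [mul_pow, hss] at h2
        have h3 : 1 / (4 * (n:ℝ)) * (2 ^ 2 * n) ≤ 1 / (4 * (n:ℝ)) * (ham x y - n * δ') ^ 2 :=
          mul_le_mul_of_nonneg_left h2 (by positivity)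
        have h4 : 1 / (4 * (n:ℝ)) * (2 ^ 2 * n) = 1 := by field_simp; norm_num
        linarith
    rw [EE_add, EE_smul, EE_one q (fun i => hW1 _)] at h1
    have h3 := mul_le_mul_of_nonneg_left hvar (show 0 ≤ 1 / (4 * (n:ℝ)) by positivity)
    have h4 : 1 / (4 * (n:ℝ)) * n = 1 / 4 := by field_simp
    linarith
  set lam := Real.log (1 - δ') - Real.log δ' with hlam
  have hlam0 : 0 ≤ lam := by
    linarith [Real.log_le_log hδ' (show δ' ≤ 1 - δ' by linarith)]
  set A := n * (Hb κ - Hb δ) + 4 * √n * lam with hA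
  have hPprod : ∏ i, P (x i) = Real.exp (-(n * Hb κ)) := by
    have : ∀ i, P (x i) = Real.exp (Real.log (P (x i))) := fun i => (Real.exp_log (hPpos _)).symm
    rw [Finset.prod_congr rfl fun i _ => this i, ← Real.exp_sum,
      sum_ite_wt x (fun a => Real.log (P a)), hx, P0, P1]
    congr 1
    unfold Hb; ring
  have hVprod : ∀ y : Fin n → Fin 2, ∏ i, V (x i) (y i) =
      Real.exp (n * Real.log (1 - δ') - ham x y * lam) := by
    intro y
    have : ∀ i, V (x i) (y i) = Real.exp (Real.log (1 - δ') -
        (if x i = y i then (0:ℝ) else 1) * lam) := by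
      intro i
      simp only [hV]
      split_ifs
      · rw [zero_mul, sub_zero, Real.exp_log (by linarith)]
      · rw [hlam, one_mul, sub_sub_cancel, Real.exp_log hδ']
    rw [Finset.prod_congr rfl fun i _ => this i, ← Real.exp_sum, Finset.sum_sub_distrib,
      ← Finset.sum_mul]
    simp [ham]
  have hgibbs := Hb_gibbs δ δ' (by linarith) (by linarith) hδ' (by linarith)
  have hpt : ∀ y : Fin n → Fin 2, Real.exp (-A) * ((∏ i, q i (y i)) * F y) ≤
      if ham x y ≤ n * δ then ∏ i, θ (y i) else 0 := by
    intro y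
    have hθp : 0 ≤ ∏ i, θ (y i) := Finset.prod_nonneg fun i _ => hθnn _
    simp only [hF]
    split_ifs with h1 h2 h2
    · rw [abs_le] at h1
      have : ∏ i, q i (y i) = (∏ i, θ (y i)) *
          Real.exp ((n * Real.log (1 - δ') - ham x y * lam) + n * Hb κ) := by
        simp only [hq, hW]
        rw [Finset.prod_div_distrib, Finset.prod_mul_distrib, hVprod, hPprod, Real.exp_neg,
          Real.exp_add]
        field_simp
      rw [this, mul_one, mul_left_comm, ← Real.exp_add]
      refine mul_le_of_le_one_right hθp ?_
      rw [Real.exp_le_one_iff, hA]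
      have h3 : (n * δ - 4 * √n) * lam ≤ ham x y * lam :=
        mul_le_mul_of_nonneg_right (by linarith) hlam0
      have h4 := mul_le_mul_of_nonneg_left hgibbs hn'.le
      have h5 : n * δ * lam = n * δ * (Real.log (1 - δ')) - n * δ * Real.log δ' := by
        rw [hlam]; ring
      linarith
    · exfalso
      rw [abs_le] at h1
      linarith
    · simpa using hθp
    · simp
  have hsum := Finset.sum_le_sum (s := Finset.univ) (fun y _ => hpt y)
  rw [← Finset.mul_sum] at hsum
  have hEE : ∑ y, (∏ i, q i (y i)) * F y = EE q F := rfl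
  rw [hEE] at hsum
  refine le_trans ?_ hsum
  rw [neg_add, Real.exp_add]
  refine mul_le_mul_of_nonneg_left ?_ (Real.exp_pos _).le
  refine le_trans ?_ hF34
  have := Real.exp_neg_one_lt_d9
  linarith

lemma wt_nonneg {n : ℕ} (x : Fin n → Fin 2) : 0 ≤ wt x :=
  Finset.sum_nonneg fun i _ => by split_ifs <;> norm_num

lemma class_cover (δ : ℝ) (hδ : 0 < δ) (hδ2 : δ < 1 / 2) {n : ℕ} (hn : 0 < n)
    (hbig : 4 / δ ≤ √n) (k : ℕ) (hk : k ≤ n) (B : ℝ) (hB0 : 0 ≤ B)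
    (hB : δ ≤ (k:ℝ) / n → (k:ℝ) / n ≤ 1 - δ → n * (Hb ((k:ℝ) / n) - Hb δ) ≤ B) :
    ∃ (C : Finset (Fin n → Fin 2)) (L : ℕ), C.card ≤ 2 ^ L ∧
      (∀ x : Fin n → Fin 2, wt x = k → ∃ y ∈ C, ham x y ≤ n * δ) ∧
      L * Real.log 2 ≤ B + 4 * √n * Real.log (2 / δ) + Real.log (2 * n) + 2 := by
  classical
  have hn' : (0:ℝ) < n := by exact_mod_cast hn
  have hn1 : (1:ℝ) ≤ n := by exact_mod_cast hn
  have hs : 0 < √(n:ℝ) := Real.sqrt_pos.2 hn'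
  have hss : √(n:ℝ) ^ 2 = n := Real.sq_sqrt hn'.le
  have hlog2d : 0 ≤ Real.log (2 / δ) := Real.log_nonneg (by rw [one_le_div hδ]; linarith)
  have hlog2n : 0 ≤ Real.log (2 * n) := Real.log_nonneg (by linarith)
  have hrhs : 0 ≤ B + 4 * √n * Real.log (2 / δ) + Real.log (2 * n) + 2 := by positivity
  rcases lt_or_ge ((k:ℝ) / n) δ with h | h
  · refine ⟨{fun _ => 0}, 0, by simp, ?_, by simpa using hrhs⟩
    intro x hx
    refine ⟨_, Finset.mem_singleton_self _, ?_⟩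
    have : ham x (fun _ => 0) = wt x := by
      refine Finset.sum_congr rfl fun i _ => ?_
      generalize x i = b
      fin_cases b <;> simp
    rw [this, hx]
    rw [div_lt_iff₀ hn'] at h
    linarith
  rcases lt_or_ge (1 - δ) ((k:ℝ) / n) with h' | h'
  · refine ⟨{fun _ => 1}, 0, by simp, ?_, by simpa using hrhs⟩
    intro x hx
    refine ⟨_, Finset.mem_singleton_self _, ?_⟩
    have : ham x (fun _ => 1) = n - wt x := by
      have := sum_ite_wt x (fun a => if a = 1 then 0 else 1)
      simpa [ham] using this
    rw [this, hx]
    rw [lt_div_iff₀ hn'] at h'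
    linarith
  have hB' := hB h h'
  set κ := (k:ℝ) / n with hκ
  set δ' := δ - 2 / √n with hδ'
  have h2s : 2 / √(n:ℝ) ≤ δ / 2 := by
    rw [div_le_iff₀ hδ] at hbig
    rw [div_le_iff₀ hs]; linarith
  have h2s0 : 0 < 2 / √(n:ℝ) := by positivity
  have hδ'0 : δ / 2 ≤ δ' := by linarith
  have hlam : Real.log (1 - δ') - Real.log δ' ≤ Real.log (2 / δ) := by
    rw [← Real.log_div (by linarith) (by linarith)]
    refine Real.log_le_log (div_pos (by linarith) (by linarith)) ?_
    rw [div_le_div_iff₀ (by linarith) hδ]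
    nlinarith
  set G := B + 4 * √n * Real.log (2 / δ) + 1 with hG
  have hG0 : 0 ≤ G := by positivity
  set q := Real.exp (-G) with hq
  have hq1 : q ≤ 1 := by rw [hq, Real.exp_le_one_iff]; linarith
  set s := (κ - δ') / (1 - 2 * δ') with hsdef
  have h12 : 0 < 1 - 2 * δ' := by linarith
  have hs0 : 0 ≤ s := div_nonneg (by linarith) h12.le
  have hs1 : s ≤ 1 := by rw [hsdef, div_le_one h12]; linarith
  set θ : Fin 2 → ℝ := ![1 - s, s] with hθ
  have hθnn : ∀ b, 0 ≤ θ b := by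
    intro b; fin_cases b
    · simp [hθ]; exact hs1
    · simp [hθ]; exact hs0
  set T : Finset (Fin n → Fin 2) := Finset.univ.filter fun x => wt x = k with hT
  set N := ⌈n * Real.exp G⌉₊ with hN
  obtain ⟨C, hC, hU⟩ := greedy_cover (fun y : Fin n → Fin 2 => ∏ i, θ (y i))
    (fun y => Finset.prod_nonneg fun i _ => hθnn _)
    (by
      have := EE_one (fun _ : Fin n => θ) (fun i => by simp [hθ, Fin.sum_univ_two])
      simpa [EE] using this)
    (fun x y => ham x y ≤ n * δ) T q hq1
    (by
      intro x hx
      have hx' : wt x = k := (Finset.mem_filter.1 hx).2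
      refine le_trans ?_ (ball_prob δ δ' (by linarith) (by linarith) hδ2 hn
        (by
          rw [hδ']
          have : (n:ℝ) * (2 / √n) = 2 * √n := by
            nth_rewrite 1 [← hss]; field_simp
          rw [mul_sub, this]; ring) κ (by linarith) (by linarith) θ hθ x
        (by rw [hx', hκ]; field_simp))
      rw [hq, Real.exp_le_exp, neg_le_neg_iff, hG]
      have : 4 * √n * (Real.log (1 - δ') - Real.log δ') ≤ 4 * √n * Real.log (2 / δ) :=
        mul_le_mul_of_nonneg_left hlam (by positivity)
      linarith) N
  have hNle : (N:ℝ) ≤ 2 * n * Real.exp G := by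
    have h1 : (N:ℝ) < n * Real.exp G + 1 := Nat.ceil_lt_add_one (by positivity)
    have h2 : 1 ≤ Real.exp G := Real.one_le_exp hG0
    nlinarith
  have hNge : n * Real.exp G ≤ N := Nat.le_ceil _
  have hempty : (T.filter fun x => ∀ y ∈ C, ¬ ham x y ≤ n * δ).card = 0 := by
    have h1 : (1 - q) ^ N ≤ Real.exp (-n) := by
      have h2 : 1 - q ≤ Real.exp (-q) := by linarith [Real.add_one_le_exp (-q)]
      calc (1 - q) ^ N ≤ Real.exp (-q) ^ N := pow_le_pow_left₀ (by linarith) h2 N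
        _ = Real.exp (-(N * q)) := by rw [← Real.exp_nat_mul]; ring_nf
        _ ≤ Real.exp (-n) := by
            rw [Real.exp_le_exp, neg_le_neg_iff]
            have := mul_le_mul_of_nonneg_right hNge (Real.exp_pos (-G)).le
            rwa [mul_assoc, ← Real.exp_add, add_neg_cancel, Real.exp_zero, mul_one] at this
    have h2 : (T.card : ℝ) ≤ 2 ^ n := by
      have := Finset.card_le_univ T
      simp only [Fintype.card_fun, Fintype.card_fin] at this
      exact_mod_cast this
    have h3 : Real.exp (-n) * 2 ^ n < 1 := by
      rw [Real.exp_neg, inv_mul_lt_iff₀ (Real.exp_pos _), mul_one]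
      have : Real.exp n = Real.exp 1 ^ n := by rw [← Real.exp_nat_mul]; ring_nf
      rw [this]
      exact pow_lt_pow_left₀ (by linarith [Real.exp_one_gt_d9]) (by norm_num) hn.ne'
    have h4 : (1 - q) ^ N * (T.card : ℝ) ≤ Real.exp (-n) * 2 ^ n :=
      mul_le_mul h1 h2 (by positivity) (Real.exp_pos _).le
    have h5 : ((T.filter fun x => ∀ y ∈ C, ¬ ham x y ≤ n * δ).card : ℝ) < 1 := by linarith
    have h6 : (T.filter fun x => ∀ y ∈ C, ¬ ham x y ≤ n * δ).card < 1 := by exact_mod_cast h5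
    omega
  have hl2 : 0 < Real.log 2 := Real.log_pos (by norm_num)
  have hlogeq : Real.log (2 * n * Real.exp G) = Real.log (2 * n) + G := by
    rw [Real.log_mul (by positivity) (Real.exp_pos _).ne', Real.log_exp]
  refine ⟨C, ⌈Real.log (2 * n * Real.exp G) / Real.log 2⌉₊, ?_, ?_, ?_⟩
  · refine hC.trans ?_
    have : (N:ℝ) ≤ 2 ^ ⌈Real.log (2 * n * Real.exp G) / Real.log 2⌉₊ := by
      refine hNle.trans ?_
      rw [← Real.log_le_log_iff (by positivity) (by positivity), Real.log_pow]
      have := Nat.le_ceil (Real.log (2 * n * Real.exp G) / Real.log 2)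
      rwa [div_le_iff₀ hl2] at this
    exact_mod_cast this
  · intro x hx
    by_contra! hcon
    rw [Finset.card_eq_zero, Finset.filter_eq_empty_iff] at hempty
    refine hempty (show x ∈ T by simp [hT, hx]) ?_
    intro y hy
    exact not_le.2 (hcon y hy)
  · have h1 := Nat.ceil_lt_add_one (show 0 ≤ Real.log (2 * n * Real.exp G) / Real.log 2 by
      rw [hlogeq]; positivity)
    have h2 := mul_lt_mul_of_pos_right h1 hl2
    rw [add_mul, div_mul_cancel₀ _ hl2.ne', hlogeq] at h2
    have := Real.log_two_lt_d9
    rw [hlogeq]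
    linarith

lemma code_upper (ρmax : ℝ) (hρ : 0 < ρmax) (d : ℝ) (hd : 0 < d) (hd2 : d < ρmax / 2)
    {n : ℕ} (hn : 0 < n) (hbig : 4 / (d / ρmax) ≤ √n) (p : Fin 2 → ℝ) (hp : IsProb p) :
    ∃ (φ : (Fin n → Fin 2) → (Fin n → Fin 2))
        (f : (Fin n → Fin 2) → List Bool)
        (g : List Bool → (Fin n → Fin 2)),
        (∀ x, nDist (binDist ρmax) x (φ x) ≤ d) ∧
        (∀ x, g (f (φ x)) = φ x) ∧
        (∀ x₁ x₂, f (φ x₁) <+: f (φ x₂) → f (φ x₁) = f (φ x₂)) ∧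
        (Real.log 2 / n) *
              (∑ x : Fin n → Fin 2, prodProb p x * ((f (φ x)).length : ℝ))
            - RD p d (binDist ρmax) ≤
          (Real.log (1 - d / ρmax) - Real.log (d / ρmax) + 4 * Real.log (2 / (d / ρmax)) + 8)
            / √n := by
  classical
  have hδ : 0 < d / ρmax := by positivity
  have hδ2 : d / ρmax < 1 / 2 := by rw [div_lt_iff₀ hρ]; linarith
  have hn' : (0:ℝ) < n := by exact_mod_cast hn
  have hn1 : (1:ℝ) ≤ n := by exact_mod_cast hn
  have hs : 0 < √(n:ℝ) := Real.sqrt_pos.2 hn'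
  have hs1 : 1 ≤ √(n:ℝ) := Real.one_le_sqrt.2 hn1
  have hss : √(n:ℝ) ^ 2 = n := Real.sq_sqrt hn'.le
  have hl2 : 0 < Real.log 2 := Real.log_pos (by norm_num)
  have hHR := Hb_le_RD ρmax d hρ hd hd2 p hp
  have hR0 := RD_nonneg ρmax d hd p hp
  simp only [nDist_le_iff hn ρmax d hρ]
  set δ := d / ρmax with hδdef
  set R := RD p d (binDist ρmax) with hR
  set Λ := Real.log (1 - δ) - Real.log δ with hΛdef
  have hΛ : 0 ≤ Λ := by
    linarith [Real.log_le_log hδ (show δ ≤ 1 - δ by linarith)]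
  set D := 4 * √n * Real.log (2 / δ) + Real.log (2 * n) + 2 with hD
  have hcov : ∀ k : Fin (n+1), ∃ (C : Finset (Fin n → Fin 2)) (L : ℕ), C.card ≤ 2 ^ L ∧
      (∀ x : Fin n → Fin 2, wt x = (k:ℕ) → ∃ y ∈ C, ham x y ≤ n * δ) ∧
      L * Real.log 2 ≤ (n * R + Λ * |((k:ℕ):ℝ) - n * p 1|) + D := by
    intro k
    obtain ⟨C, L, h1, h2, h3⟩ := class_cover δ hδ hδ2 hn hbig k (by omega)
      (n * R + Λ * |((k:ℕ):ℝ) - n * p 1|) (by positivity) (by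
        intro h h'
        have h1 := mul_le_mul_of_nonneg_left (hHR _ h h') hn'.le
        refine h1.trans (le_of_eq ?_)
        rw [mul_add]
        congr 1
        rw [mul_left_comm]
        congr 1
        nth_rewrite 1 [← abs_of_pos hn']
        rw [← abs_mul]
        congr 1
        field_simp)
    exact ⟨C, L, h1, h2, by rw [hD]; linarith⟩
  choose C L hC1 hC2 hC3 using hcov
  set cnt : (Fin n → Fin 2) → Fin (n+1) := fun x =>
    ⟨(Finset.univ.filter fun i => x i = 1).card, by
      have := Finset.card_le_univ (Finset.univ.filter fun i => x i = 1)
      simp only [Fintype.card_fin] at this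
      omega⟩ with hcnt
  have hcntwt : ∀ x, wt x = ((cnt x : ℕ) : ℝ) := by
    intro x; simp [wt, hcnt]
  set w := Nat.log 2 n + 1 with hw
  obtain ⟨φ, f, g, h1, h2, h3, h4⟩ := two_part_code (n+1) w
    (Nat.lt_pow_succ_log_self (by norm_num) n) cnt C L hC1 (fun x y => ham x y ≤ n * δ)
    (fun x => hC2 _ x (hcntwt x))
  refine ⟨φ, f, g, h1, h2, h3, ?_⟩
  have hEq : (∑ x : Fin n → Fin 2, prodProb p x * ((f (φ x)).length : ℝ)) =
      EE (fun _ : Fin n => p) (fun x => ((f (φ x)).length : ℝ)) := rfl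
  rw [hEq]
  set q : Fin n → Fin 2 → ℝ := fun _ => p with hq
  have hp2 := hp.2
  simp only [Fin.sum_univ_two] at hp2
  have hp0 := hp.1
  have hq1 : ∀ i, ∑ a, q i a = 1 := fun i => hp.2
  set G : Fin 2 → ℝ := fun a => (if a = 1 then 1 else 0) - p 1 with hG
  have hZ : ∀ x : Fin n → Fin 2, ∑ i, G (x i) = wt x - n * p 1 := by
    intro x; simp [hG, wt, Finset.sum_sub_distrib]
  have habs := EE_abs_upper hn q (fun _ => G) (fun i a => hp0 a) hq1
    (by intro i; simp [hq, hG, Fin.sum_univ_two]; linear_combination (-(p 1)) * hp2)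
    (by
      intro i a; rw [abs_le]
      have := hp0 0
      have := hp0 1
      fin_cases a <;> simp [hG] <;> constructor <;> linarith)
  simp only [hZ] at habs
  have hwlog : w * Real.log 2 ≤ 2 * √n + 1 := by
    have ha : (2:ℝ) ^ (Nat.log 2 n) ≤ n := by exact_mod_cast Nat.pow_log_le_self 2 hn.ne'
    have hb := Real.log_le_log (by positivity) ha
    rw [Real.log_pow] at hb
    have hc : Real.log n ≤ 2 * √n := by
      rw [← hss, Real.log_pow, hss]
      have := Real.log_le_sub_one_of_pos hs
      push_cast; linarith
    have := Real.log_two_lt_d9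
    rw [hw]; push_cast
    linarith
  have hlog2n : Real.log (2 * n) ≤ 2 * √n + 1 := by
    have hc : Real.log n ≤ 2 * √n := by
      rw [← hss, Real.log_pow, hss]
      have := Real.log_le_sub_one_of_pos hs
      push_cast; linarith
    rw [Real.log_mul (by norm_num) hn'.ne']
    have := Real.log_two_lt_d9
    linarith
  have hmain : EE q (fun x => Real.log 2 * ((f (φ x)).length : ℝ)) ≤
      EE q (fun x => (w * Real.log 2 + n * R + D) + Λ * |wt x - n * p 1|) := by
    refine EE_mono q (fun i a => hp0 a) _ _ fun x => ?_
    have ha : ((f (φ x)).length : ℝ) ≤ w + L (cnt x) := by exact_mod_cast h4 x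
    have hb := hC3 (cnt x)
    rw [← hcntwt] at hb
    have hc := mul_le_mul_of_nonneg_left ha hl2.le
    linarith
  rw [EE_smul, EE_add, EE_smul, EE_const q hq1] at hmain
  have hΛE := mul_le_mul_of_nonneg_left habs hΛ
  have hfin : Real.log 2 * EE q (fun x => ((f (φ x)).length : ℝ)) ≤
      n * R + (Λ + 4 * Real.log (2 / δ) + 8) * √n := by
    linarith
  rw [sub_le_iff_le_add, div_mul_eq_mul_div, div_le_iff₀ hn']
  refine hfin.trans (le_of_eq ?_)
  have : ∀ c : ℝ, c / √n * n = c * √n := by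
    intro c
    nth_rewrite 2 [← hss]; field_simp
  linear_combination -(this (Λ + 4 * Real.log (2 / δ) + 8))

/-! ### Assembling the bounds -/

lemma liminf_pos (ρmax : ℝ) (hρ : 0 < ρmax) (d : ℝ) (hd : 0 < d) (hd2 : d < ρmax / 2)
    (pre : Bool) :
    0 < Filter.liminf (fun n : ℕ => Real.sqrt n * maxMinRedundancy ρmax d pre n) atTop := by
  have hδ : 0 < d / ρmax := by positivity
  have hδ2 : d / ρmax < 1 / 2 := by rw [div_lt_iff₀ hρ]; linarith
  set K := Real.log (1 - d / ρmax) - Real.log (d / ρmax) + 4 * Real.log (2 / (d / ρmax)) + 8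
    with hK
  set p : Fin 2 → ℝ := ![1 - d / ρmax, d / ρmax] with hp
  have hpP : IsProb p := by
    refine ⟨fun a => ?_, by simp [hp, Fin.sum_univ_two]⟩
    fin_cases a
    · simp [hp]; linarith
    · simp [hp]; exact hδ.le
  have hRD : RD p d (binDist ρmax) ≤ 0 := RD_crit ρmax d hρ p hpP (by simp [hp])
  set δ := d / ρmax with hδdef
  set a := Real.log ((1 - δ) / δ) * (δ * (1 - δ) / (2 * √(6 / (δ * (1 - δ))))) / 4 with ha
  have ha0 : 0 < a := by
    have h1 : 0 < Real.log ((1 - δ) / δ) := Real.log_pos (by rw [one_lt_div hδ]; linarith)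
    have h2 : 0 < δ * (1 - δ) := mul_pos hδ (by linarith)
    positivity
  have hsq : Tendsto (fun n : ℕ => √(n:ℝ)) atTop atTop :=
    Real.tendsto_sqrt_atTop.comp tendsto_natCast_atTop_atTop
  have hev : ∀ᶠ n : ℕ in atTop, a / 2 ≤ √n * maxMinRedundancy ρmax d pre n ∧
      √n * maxMinRedundancy ρmax d pre n ≤ K := by
    filter_upwards [hsq.eventually_ge_atTop (4 / δ), hsq.eventually_ge_atTop (2 / a),
      eventually_gt_atTop 0] with n hn1 hn2 hn
    have hn' : (0:ℝ) < n := by exact_mod_cast hn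
    have hs : 0 < √(n:ℝ) := Real.sqrt_pos.2 hn'
    have hss : √(n:ℝ) ^ 2 = n := Real.sq_sqrt hn'.le
    have hub : ∀ v ∈ { v : ℝ | ∃ p : Fin 2 → ℝ, IsProb p ∧
        v = sInf { r : ℝ |
      ∃ (φ : (Fin n → Fin 2) → (Fin n → Fin 2))
        (f : (Fin n → Fin 2) → List Bool)
        (g : List Bool → (Fin n → Fin 2)),
        (∀ x, nDist (binDist ρmax) x (φ x) ≤ d) ∧
        (∀ x, g (f (φ x)) = φ x) ∧
        (pre = true → ∀ x₁ x₂, f (φ x₁) <+: f (φ x₂) → f (φ x₁) = f (φ x₂)) ∧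
        r = (Real.log 2 / n) *
              (∑ x : Fin n → Fin 2, prodProb p x * ((f (φ x)).length : ℝ))
            - RD p d (binDist ρmax) } }, v ≤ K / √n := by
      rintro v ⟨p', hp', rfl⟩
      obtain ⟨φ, f, g, h1, h2, h3, h4⟩ := code_upper ρmax hρ d hd hd2 hn hn1 p' hp'
      refine le_trans (csInf_le ?_ ⟨φ, f, g, h1, h2, fun _ => h3, rfl⟩) h4
      refine ⟨-RD p' d (binDist ρmax), ?_⟩
      rintro r ⟨φ, f, g, -, -, -, rfl⟩
      have h5 : 0 ≤ ∑ x : Fin n → Fin 2, prodProb p' x * ((f (φ x)).length : ℝ) :=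
        Finset.sum_nonneg fun x _ => mul_nonneg (Finset.prod_nonneg fun i _ => hp'.1 _)
          (Nat.cast_nonneg _)
      have h6 : 0 ≤ Real.log 2 / n := div_nonneg (Real.log_nonneg (by norm_num)) hn'.le
      have := mul_nonneg h6 h5
      linarith
    constructor
    · have hlow : (a * √n - 1) / n ≤ maxMinRedundancy ρmax d pre n := by
        refine le_csSup_of_le ⟨K / √n, hub⟩ ⟨p, hpP, rfl⟩ ?_
        obtain ⟨φ, f, g, h1, h2, h3, -⟩ := code_upper ρmax hρ d hd hd2 hn hn1 p hpP
        refine le_csInf ⟨_, φ, f, g, h1, h2, fun _ => h3, rfl⟩ ?_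
        rintro r ⟨φ, f, g, h1, h2, -, rfl⟩
        simp only [nDist_le_iff hn ρmax d hρ] at h1
        have h5 := code_lower δ hδ hδ2 φ f g h1 h2 p hp
        have hEq : (∑ x : Fin n → Fin 2, prodProb p x * ((f (φ x)).length : ℝ)) =
          EE (fun _ : Fin n => p) (fun x => ((f (φ x)).length : ℝ)) := rfl
        rw [hEq]
        have hl4 : Real.log 4 = 2 * Real.log 2 := by
          rw [show (4:ℝ) = 2 ^ 2 by norm_num, Real.log_pow]; norm_num
        rw [hl4] at h5
        have h6 : a * √n - 1 ≤
            Real.log 2 * EE (fun _ : Fin n => p) (fun x => ((f (φ x)).length : ℝ)) := by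
          rw [ha]; linarith
        have h7 := div_le_div_of_nonneg_right h6 hn'.le
        rw [div_mul_eq_mul_div (Real.log 2)]
        linarith
      have h8 := mul_le_mul_of_nonneg_left hlow hs.le
      refine le_trans ?_ h8
      rw [mul_div_assoc', le_div_iff₀ hn', ← hss]
      rw [Real.sqrt_sq hs.le]
      rw [div_le_iff₀ ha0] at hn2
      nlinarith
    · have h1 : maxMinRedundancy ρmax d pre n ≤ K / √n :=
        csSup_le ⟨_, p, hpP, rfl⟩ hub
      have h2 := mul_le_mul_of_nonneg_left h1 hs.le
      rwa [mul_div_cancel₀ _ hs.ne'] at h2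
  refine lt_of_lt_of_le (half_pos ha0) ?_
  refine Filter.le_liminf_of_le ?_ (hev.mono fun n h => h.1)
  exact Filter.isCoboundedUnder_ge_of_eventually_le atTop (hev.mono fun n h => h.2)

/-- Corollary 5: for the binary Hamming distortion with
`d ∈ (0, ρmax/2)`, `liminf_{n→∞} √n · sup_p inf_{prefix codes} [redundancy] > 0`,
and the same holds with the infimum over all (not necessarily prefix) codes:
the worst-case redundancy is `Ω(1/√n)` even with the code optimized for the source. -/
theorem redundancy_lower_bound_binary (ρmax : ℝ) (hρmax : 0 < ρmax)
    (d : ℝ) (hd : 0 < d) (hd2 : d < ρmax / 2) :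
    0 < Filter.liminf (fun n : ℕ => Real.sqrt n * maxMinRedundancy ρmax d true n) atTop ∧
    0 < Filter.liminf (fun n : ℕ => Real.sqrt n * maxMinRedundancy ρmax d false n) atTop := by
  exact ⟨liminf_pos ρmax hρmax d hd hd2 true, liminf_pos ρmax hρmax d hd hd2 false⟩
end
end

section
/- Fix d > 0. For every n ≥ 10, every n-type t ∈ P_n(A), every distortion measure ρ ∈ D, and every x^n in the type class T_A^n(t): if Y^n is i.i.d. according to the optimal output distribution Q^{t,d,ρ}, then P( ρ_n(x^n, Y^n) ≤ d + 2ρ_max/n^{5/8} ) ≥ exp( −n·R(t,d,ρ) − 2ρ_max·λ*·n^{3/8} − (1/8)·ln n + ln(1/2) ). Since λ* ≤ min(ln J, ln K)/d, the ratio of this probability to e^{−n R(t,d,ρ)} is bounded below by exp( −(2ρ_max·min(ln J,ln K)/d)·n^{3/8} − (1/8)ln n + ln(1/2) ), uniformly over t, ρ, and x^n. -/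
open Filter MeasureTheory
open scoped BigOperators

noncomputable section

variable {A B : Type*}

/-- `(Q, lam)` solves the Lagrangian formulation of the rate-distortion problem
`R(t,d,ρ)`: `Q` is an optimal (feasible, minimizing) conditional distribution,
`lam ≥ 0` satisfies complementary slackness, and `−lam` is a subgradient of
`R(t,·,ρ)` at `d`. -/
def IsLagrange [Fintype A] [Fintype B] (t : A → ℝ) (d : ℝ) (ρ : A → B → ℝ)
    (Q : A → B → ℝ) (lam : ℝ) : Prop :=
  IsCondProb Q ∧ avgDist t Q ρ ≤ d ∧ mutualInfo t Q = RD t d ρ ∧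
  0 ≤ lam ∧ lam * (avgDist t Q ρ - d) = 0 ∧
  ∀ d' : ℝ, 0 < d' → RD t d ρ - lam * (d' - d) ≤ RD t d' ρ

/-! ### Part 1: Gaussian smoothing and a quantitative central limit estimate -/

lemma ls_exp_taylor_nonneg (x : ℝ) (hx : 0 ≤ x) :
    ‖Complex.exp (Complex.I * x) - 1 - Complex.I * x + (x : ℂ) ^ 2 / 2‖ ≤ x ^ 3 / 6 := by
  have hd : ∀ y : ℝ, HasDerivAt (fun y : ℝ => Complex.exp (Complex.I * y))
      (Complex.exp (Complex.I * y) * Complex.I) y := by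
    intro y
    have h1 : HasDerivAt (fun y : ℝ => Complex.I * (y : ℂ)) (Complex.I * 1) y :=
      (Complex.ofRealCLM.hasDerivAt (x := y)).const_mul Complex.I
    simpa using h1.cexp
  have hid : ∀ y : ℝ, HasDerivAt (fun y : ℝ => Complex.I * (y : ℂ)) Complex.I y := by
    intro y
    simpa using (Complex.ofRealCLM.hasDerivAt (x := y)).const_mul Complex.I
  have hsq : ∀ y : ℝ, HasDerivAt (fun y : ℝ => (y : ℂ) ^ 2 / 2) (y : ℂ) y := by
    intro y
    have := (((Complex.ofRealCLM.hasDerivAt (x := y))).pow 2).div_const 2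
    convert! this using 1
    simp
  have h2 : ∀ y : ℝ, 0 ≤ y →
      ‖Complex.exp (Complex.I * y) - 1 - Complex.I * y‖ ≤ y ^ 2 / 2 := by
    intro y hy
    have hder : ∀ z : ℝ, HasDerivAt
        (fun y : ℝ => Complex.exp (Complex.I * y) - 1 - Complex.I * y)
        (Complex.exp (Complex.I * z) * Complex.I - Complex.I) z := by
      intro z
      exact ((hd z).sub_const 1).sub (hid z)
    refine image_norm_le_of_norm_deriv_right_le_deriv_boundary
      (f := fun y : ℝ => Complex.exp (Complex.I * y) - 1 - Complex.I * y) (a := 0) (b := y)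
      (f' := fun z : ℝ => Complex.exp (Complex.I * z) * Complex.I - Complex.I)
      (B := fun y => y ^ 2 / 2) (B' := fun y => y)
      (fun z _ => (hder z).continuousAt.continuousWithinAt)
      (fun z _ => (hder z).hasDerivWithinAt) (by simp) ?_ ?_ ⟨hy, le_refl y⟩
    · intro z
      have := ((hasDerivAt_id z).pow 2).div_const 2
      convert! this using 1
      simp
    · intro z hz
      have : Complex.exp (Complex.I * z) * Complex.I - Complex.I
        = (Complex.exp (Complex.I * z) - 1) * Complex.I := by ring
      rw [this, norm_mul, Complex.norm_I, mul_one]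
      have := Real.norm_exp_I_mul_ofReal_sub_one_le (x := z)
      rwa [Real.norm_of_nonneg hz.1] at this
  have hder : ∀ z : ℝ, HasDerivAt
      (fun y : ℝ => Complex.exp (Complex.I * y) - 1 - Complex.I * y + (y : ℂ) ^ 2 / 2)
      (Complex.exp (Complex.I * z) * Complex.I - Complex.I + z) z := by
    intro z
    exact (((hd z).sub_const 1).sub (hid z)).add (hsq z)
  refine image_norm_le_of_norm_deriv_right_le_deriv_boundary
    (f := fun y : ℝ => Complex.exp (Complex.I * y) - 1 - Complex.I * y + (y : ℂ) ^ 2 / 2)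
    (a := 0) (b := x)
    (f' := fun z : ℝ => Complex.exp (Complex.I * z) * Complex.I - Complex.I + z)
    (B := fun y => y ^ 3 / 6) (B' := fun y => y ^ 2 / 2)
    (fun z _ => (hder z).continuousAt.continuousWithinAt)
    (fun z _ => (hder z).hasDerivWithinAt) (by simp) ?_ ?_ ⟨hx, le_refl x⟩
  · intro z
    have := ((hasDerivAt_id z).pow 3).div_const 6
    convert! this using 1
    simp; ring
  · intro z hz
    have : Complex.exp (Complex.I * z) * Complex.I - Complex.I + z
      = (Complex.exp (Complex.I * z) - 1 - Complex.I * z) * Complex.I := by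
      ring_nf; rw [Complex.I_sq]; ring
    rw [this, norm_mul, Complex.norm_I, mul_one]
    exact h2 z hz.1

lemma ls_exp_taylor (x : ℝ) :
    ‖Complex.exp (Complex.I * x) - 1 - Complex.I * x + (x : ℂ) ^ 2 / 2‖ ≤ |x| ^ 3 / 6 := by
  rcases le_total 0 x with hx | hx
  · rw [abs_of_nonneg hx]; exact ls_exp_taylor_nonneg x hx
  · rw [abs_of_nonpos hx]
    have h := ls_exp_taylor_nonneg (-x) (by linarith)
    rw [← Complex.norm_conj] at h
    convert h using 2
    have h2 : (starRingEnd ℂ) 2 = 2 := Complex.conj_ofNat 2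
    simp [← Complex.exp_conj, h2, sub_eq_add_neg]

lemma ls_real_exp_quad (y : ℝ) (hy : 0 ≤ y) :
    |Real.exp (-y) - 1 + y| ≤ y ∧ |Real.exp (-y) - 1 + y| ≤ y ^ 2 / 2 := by
  have h0 : 0 ≤ Real.exp (-y) - 1 + y := by
    have := Real.add_one_le_exp (-y); linarith
  rw [abs_of_nonneg h0]
  constructor
  · have : Real.exp (-y) ≤ 1 := Real.exp_le_one_iff.2 (by linarith)
    linarith
  · have h1 : 1 + y + y ^ 2 / 2 ≤ Real.exp y := Real.quadratic_le_exp_of_nonneg hy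
    have h3 : Real.exp (-y) * Real.exp y = 1 := by rw [← Real.exp_add]; simp
    have h4 : (1 - y + y ^ 2 / 2) * (1 + y + y ^ 2 / 2) ≥ 1 := by nlinarith [sq_nonneg (y^2)]
    have h5 : 0 < 1 - y + y ^ 2 / 2 := by nlinarith [sq_nonneg (y - 1)]
    have h6 : 1 ≤ (1 - y + y ^ 2 / 2) * Real.exp y :=
      h4.le.trans (mul_le_mul_of_nonneg_left h1 h5.le)
    have h7 : Real.exp (-y) * Real.exp y ≤ (1 - y + y ^ 2 / 2) * Real.exp y := by rw [h3]; exact h6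
    have := le_of_mul_le_mul_right h7 (Real.exp_pos y)
    linarith

/-- One-letter comparison of characteristic functions. -/
lemma ls_one_step {K : ℕ} (p X : Fin K → ℝ) (hp : IsProb p) (h0 : ∑ k, p k * X k = 0)
    (hX : ∀ k, |X k| ≤ 1) (hv : ∑ k, p k * X k ^ 2 ≤ 1 / 4) (s : ℝ) :
    ‖(∑ k, (p k : ℂ) * Complex.exp (Complex.I * ((s * X k : ℝ) : ℂ)))
      - (Real.exp (-(s ^ 2 * (∑ k, p k * X k ^ 2) / 2)) : ℂ)‖
      ≤ 7 / 24 * |s| ^ 3 * ∑ k, p k * X k ^ 2 := by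
  set v := ∑ k, p k * X k ^ 2 with hvdef
  have hv0 : 0 ≤ v := Finset.sum_nonneg fun k _ => mul_nonneg (hp.1 k) (sq_nonneg _)
  have e1 : ‖(∑ k, (p k : ℂ) * Complex.exp (Complex.I * ((s * X k : ℝ) : ℂ)))
      - ((1 - s ^ 2 * v / 2 : ℝ) : ℂ)‖ ≤ |s| ^ 3 * v / 6 := by
    have : (∑ k, (p k : ℂ) * Complex.exp (Complex.I * ((s * X k : ℝ) : ℂ)))
      - ((1 - s ^ 2 * v / 2 : ℝ) : ℂ) = ∑ k, (p k : ℂ) *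
        (Complex.exp (Complex.I * ((s * X k : ℝ) : ℂ)) - 1 - Complex.I * ((s * X k : ℝ) : ℂ)
          + ((s * X k : ℝ) : ℂ) ^ 2 / 2) := by
      have a1 : ∑ k, (p k : ℂ) = 1 := by exact_mod_cast hp.2
      have a2 : ∑ k, (p k : ℂ) * (X k : ℂ) = 0 := by exact_mod_cast h0
      have a3 : ∑ k, (p k : ℂ) * (X k : ℂ) ^ 2 = (v : ℂ) := by
        rw [hvdef]; push_cast; rfl
      have : ∀ k, (p k : ℂ) *
        (Complex.exp (Complex.I * ((s * X k : ℝ) : ℂ)) - 1 - Complex.I * ((s * X k : ℝ) : ℂ)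
          + ((s * X k : ℝ) : ℂ) ^ 2 / 2) =
          (p k : ℂ) * Complex.exp (Complex.I * ((s * X k : ℝ) : ℂ)) - (p k : ℂ)
          - Complex.I * s * ((p k : ℂ) * (X k : ℂ))
          + (s : ℂ) ^ 2 / 2 * ((p k : ℂ) * (X k : ℂ) ^ 2) := by
        intro k; push_cast; ring
      simp_rw [this]
      rw [Finset.sum_add_distrib, Finset.sum_sub_distrib, Finset.sum_sub_distrib,
        ← Finset.mul_sum, ← Finset.mul_sum, a1, a2, a3]
      push_cast; ring
    rw [this]
    refine (norm_sum_le _ _).trans ?_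
    have h : ∀ k ∈ Finset.univ, ‖(p k : ℂ) *
        (Complex.exp (Complex.I * ((s * X k : ℝ) : ℂ)) - 1 - Complex.I * ((s * X k : ℝ) : ℂ)
          + ((s * X k : ℝ) : ℂ) ^ 2 / 2)‖ ≤ |s| ^ 3 / 6 * (p k * X k ^ 2) := by
      intro k _
      rw [norm_mul, Complex.norm_real, Real.norm_of_nonneg (hp.1 k)]
      have h1 := ls_exp_taylor (s * X k)
      have h2 : |s * X k| ^ 3 ≤ |s| ^ 3 * X k ^ 2 := by
        rw [abs_mul, mul_pow]
        have : |X k| ^ 3 ≤ X k ^ 2 := by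
          rw [← sq_abs (X k)]
          nlinarith [hX k, abs_nonneg (X k), sq_nonneg (|X k|)]
        exact mul_le_mul_of_nonneg_left this (by positivity)
      calc _ ≤ p k * (|s| ^ 3 * X k ^ 2 / 6) :=
            mul_le_mul_of_nonneg_left (h1.trans (by linarith)) (hp.1 k)
        _ = _ := by ring
    refine (Finset.sum_le_sum h).trans ?_
    rw [← Finset.mul_sum, ← hvdef]
    linarith
  have e2 : ‖((1 - s ^ 2 * v / 2 : ℝ) : ℂ) - (Real.exp (-(s ^ 2 * v / 2)) : ℂ)‖
      ≤ |s| ^ 3 * v / 8 := by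
    rw [← Complex.ofReal_sub, Complex.norm_real, Real.norm_eq_abs, abs_sub_comm]
    have hy : 0 ≤ s ^ 2 * v / 2 := by positivity
    obtain ⟨q1, q2⟩ := ls_real_exp_quad _ hy
    have : Real.exp (-(s ^ 2 * v / 2)) - (1 - s ^ 2 * v / 2)
      = Real.exp (-(s ^ 2 * v / 2)) - 1 + s ^ 2 * v / 2 := by ring
    rw [this]
    have hs0 := abs_nonneg s
    rcases le_total |s| 4 with h4 | h4
    · refine q2.trans ?_
      rw [← sq_abs s]
      have e : (|s| ^ 2 * v / 2) ^ 2 / 2 = |s| ^ 3 * v * (|s| * v / 8) := by ring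
      rw [e]
      have : |s| * v ≤ 1 := by nlinarith
      have h3 : 0 ≤ |s| ^ 3 * v := by positivity
      nlinarith
    · refine q1.trans ?_
      rw [← sq_abs s]
      have h3 : 0 ≤ |s| ^ 2 * v := by positivity
      nlinarith
  have := norm_sub_le_norm_sub_add_norm_sub
    (∑ k, (p k : ℂ) * Complex.exp (Complex.I * ((s * X k : ℝ) : ℂ)))
    ((1 - s ^ 2 * v / 2 : ℝ) : ℂ) (Real.exp (-(s ^ 2 * v / 2)) : ℂ)
  linarith

lemma ls_prod_sub_prod {n : ℕ} (s : Finset (Fin n)) (f g : Fin n → ℂ)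
    (hf : ∀ i, ‖f i‖ ≤ 1) (hg : ∀ i, ‖g i‖ ≤ 1) :
    ‖∏ i ∈ s, f i - ∏ i ∈ s, g i‖ ≤ ∑ i ∈ s, ‖f i - g i‖ := by
  classical
  induction s using Finset.induction_on with
  | empty => simp
  | insert a s ha ih =>
    rw [Finset.prod_insert ha, Finset.prod_insert ha, Finset.sum_insert ha]
    have e : f a * ∏ i ∈ s, f i - g a * ∏ i ∈ s, g i
      = (f a - g a) * ∏ i ∈ s, f i + g a * (∏ i ∈ s, f i - ∏ i ∈ s, g i) := by ring
    rw [e]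
    refine (norm_add_le _ _).trans (add_le_add ?_ ?_)
    · rw [norm_mul]
      refine mul_le_of_le_one_right (norm_nonneg _) ?_
      rw [norm_prod]
      exact Finset.prod_le_one (fun i _ => norm_nonneg _) (fun i _ => hf i)
    · rw [norm_mul]
      exact (mul_le_of_le_one_left (norm_nonneg _) (hg a)).trans ih

lemma ls_gauss_char (w : ℝ) :
    ∫ z : ℝ, Complex.exp (Complex.I * ((z * w : ℝ) : ℂ)) ∂(ProbabilityTheory.gaussianReal 0 1)
      = (Real.exp (-(w ^ 2 / 2)) : ℂ) := by
  have h := ProbabilityTheory.charFun_gaussianReal (μ := 0) (v := 1) w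
  rw [charFun_apply_real] at h
  rw [Complex.ofReal_exp]
  convert h using 1
  · congr 1; ext z; congr 1; push_cast; ring
  · congr 1; push_cast; ring

lemma ls_gauss_quad (c : ℝ) (hc : 0 ≤ c) :
    ∫ z : ℝ, Real.exp (-(c * z ^ 2 / 2)) ∂(ProbabilityTheory.gaussianReal 0 1)
      = 1 / Real.sqrt (1 + c) := by
  rw [ProbabilityTheory.integral_gaussianReal_eq_integral_smul one_ne_zero]
  have : ∀ z : ℝ, ProbabilityTheory.gaussianPDFReal 0 1 z • Real.exp (-(c * z ^ 2 / 2))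
      = (Real.sqrt (2 * Real.pi))⁻¹ * Real.exp (-((1 + c) / 2) * z ^ 2) := by
    intro z
    rw [ProbabilityTheory.gaussianPDFReal_def]
    simp only [smul_eq_mul, NNReal.coe_one, mul_one, sub_zero]
    rw [mul_assoc, ← Real.exp_add]
    congr 2; ring
  simp_rw [this]
  rw [integral_const_mul, integral_gaussian, ← Real.sqrt_inv, ← Real.sqrt_mul (by positivity),
    one_div, ← Real.sqrt_inv]
  congr 1
  have := Real.pi_pos
  field_simp

lemma ls_gauss_third_int :
    Integrable (fun z : ℝ => |z| ^ 3) (ProbabilityTheory.gaussianReal 0 1) := by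
  have h := (ProbabilityTheory.memLp_id_gaussianReal (μ := 0) (v := 1) 3).integrable_norm_pow
    (by norm_num)
  simpa using h

lemma ls_gauss_third :
    ∫ z : ℝ, |z| ^ 3 ∂(ProbabilityTheory.gaussianReal 0 1) ≤ 8 / 5 := by
  rw [ProbabilityTheory.integral_gaussianReal_eq_integral_smul one_ne_zero]
  have : ∀ z : ℝ, ProbabilityTheory.gaussianPDFReal 0 1 z • |z| ^ 3
      = (Real.sqrt (2 * Real.pi))⁻¹ *
        (fun y : ℝ => y ^ (3 : ℝ) * Real.exp (-(1 / 2) * y ^ (2 : ℝ))) |z| := by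
    intro z
    rw [ProbabilityTheory.gaussianPDFReal_def]
    simp only [smul_eq_mul, NNReal.coe_one, mul_one, sub_zero]
    have e1 : |z| ^ (3 : ℝ) = |z| ^ 3 := by exact_mod_cast Real.rpow_natCast |z| 3
    have e2 : |z| ^ (2 : ℝ) = z ^ 2 := by
      rw [← sq_abs z]; exact_mod_cast Real.rpow_natCast |z| 2
    rw [e1, e2]
    have : -z ^ 2 / 2 = -(1 / 2) * z ^ 2 := by ring
    rw [this]; ring
  simp_rw [this]
  rw [integral_const_mul, integral_comp_abs (f := fun y : ℝ =>
      y ^ (3 : ℝ) * Real.exp (-(1 / 2) * y ^ (2 : ℝ))),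
    integral_rpow_mul_exp_neg_mul_rpow (by norm_num) (by norm_num) (by norm_num)]
  have g : Real.Gamma ((3 + 1) / 2) = 1 := by
    norm_num
  have r : (1 / 2 : ℝ) ^ (-((3 : ℝ) + 1) / 2) = 4 := by
    have : (-((3 : ℝ) + 1) / 2) = ((-2 : ℤ) : ℝ) := by norm_num
    rw [this, Real.rpow_intCast]; norm_num
  rw [g, r]
  have hs : (5 / 2 : ℝ) ≤ Real.sqrt (2 * Real.pi) := by
    apply Real.le_sqrt_of_sq_le
    have := Real.pi_gt_d2
    norm_num at this ⊢; linarith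
  have : (Real.sqrt (2 * Real.pi))⁻¹ ≤ (5 / 2 : ℝ)⁻¹ := inv_anti₀ (by norm_num) hs
  norm_num at this ⊢
  linarith

/-- Quantitative CLT tested against a Gaussian kernel. -/
lemma ls_fourier {n K : ℕ} (p X : Fin n → Fin K → ℝ) (hp : ∀ i, IsProb (p i))
    (h0 : ∀ i, ∑ k, p i k * X i k = 0) (hX : ∀ i k, |X i k| ≤ 1)
    (hv : ∀ i, ∑ k, p i k * X i k ^ 2 ≤ 1 / 4) (b : ℝ) (hb : 0 < b) :
    |(∑ y : Fin n → Fin K, (∏ i, p i (y i)) *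
        Real.exp (-((∑ i, X i (y i)) ^ 2 / (2 * b ^ 2))))
      - 1 / Real.sqrt (1 + (∑ i, ∑ k, p i k * X i k ^ 2) / b ^ 2)|
      ≤ 7 / 15 * (∑ i, ∑ k, p i k * X i k ^ 2) / b ^ 3 := by
  set γ := ProbabilityTheory.gaussianReal 0 1 with hγ
  set V := ∑ i, ∑ k, p i k * X i k ^ 2 with hV
  have hvi : ∀ i, 0 ≤ ∑ k, p i k * X i k ^ 2 := fun i =>
    Finset.sum_nonneg fun k _ => mul_nonneg ((hp i).1 k) (sq_nonneg _)
  have hV0 : 0 ≤ V := Finset.sum_nonneg fun i _ => hvi i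
  let φ : ℝ → ℂ := fun s => ∏ i, ∑ k, (p i k : ℂ) * Complex.exp (Complex.I * ((s * X i k : ℝ) : ℂ))
  have hφ : ∀ s, φ s = ∑ y : Fin n → Fin K, ((∏ i, p i (y i) : ℝ) : ℂ) *
      Complex.exp (Complex.I * ((s * ∑ i, X i (y i) : ℝ) : ℂ)) := by
    intro s
    simp only [φ]
    rw [Finset.prod_univ_sum, Fintype.piFinset_univ]
    refine Finset.sum_congr rfl fun y _ => ?_
    rw [Finset.prod_mul_distrib, ← Complex.exp_sum]
    push_cast
    congr 2
    rw [Finset.mul_sum, Finset.mul_sum]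
  have hcont : ∀ w : ℝ, Continuous
      fun z : ℝ => Complex.exp (Complex.I * ((z * w : ℝ) : ℂ)) := by
    intro w; fun_prop
  have hint : ∀ w : ℝ, Integrable
      (fun z : ℝ => Complex.exp (Complex.I * ((z * w : ℝ) : ℂ))) γ := by
    intro w
    refine Integrable.of_bound (hcont w).aestronglyMeasurable 1 (Filter.Eventually.of_forall ?_)
    intro z
    rw [Complex.norm_exp_I_mul_ofReal]
  have hφint : Integrable (fun z : ℝ => φ (z / b)) γ := by
    simp_rw [hφ]
    refine integrable_finsetSum _ fun y _ => ?_
    refine Integrable.const_mul ?_ _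
    convert hint ((∑ i, X i (y i)) / b) using 5
    ring
  have hI1 : ∫ z, φ (z / b) ∂γ = ((∑ y : Fin n → Fin K, (∏ i, p i (y i)) *
        Real.exp (-((∑ i, X i (y i)) ^ 2 / (2 * b ^ 2))) : ℝ) : ℂ) := by
    simp_rw [hφ]
    rw [integral_finsetSum]
    · rw [Complex.ofReal_sum]
      refine Finset.sum_congr rfl fun y _ => ?_
      rw [integral_const_mul, Complex.ofReal_mul]
      congr 1
      have := ls_gauss_char ((∑ i, X i (y i)) / b)
      rw [← hγ] at this
      convert this using 1
      · congr 1; ext z; congr 3; ring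
      · congr 3; rw [div_pow]; field_simp
    · intro y _
      refine Integrable.const_mul ?_ _
      convert hint ((∑ i, X i (y i)) / b) using 5
      ring
  let ψ : ℝ → ℝ := fun z => Real.exp (-(V / b ^ 2 * z ^ 2 / 2))
  have hψint : Integrable ψ γ := by
    refine Integrable.of_bound (by fun_prop) 1 (Filter.Eventually.of_forall ?_)
    intro z
    rw [Real.norm_of_nonneg (Real.exp_pos _).le, Real.exp_le_one_iff]
    have : 0 ≤ V / b ^ 2 * z ^ 2 / 2 := by positivity
    linarith
  have hI2 : ∫ z, (ψ z : ℂ) ∂γ = ((1 / Real.sqrt (1 + V / b ^ 2) : ℝ) : ℂ) := by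
    refine (integral_ofReal (𝕜 := ℂ) (f := ψ)).trans ?_
    refine congrArg (fun r : ℝ => (r : ℂ)) ?_
    exact ls_gauss_quad _ (by positivity)
  have hpt : ∀ z, ‖φ (z / b) - (ψ z : ℂ)‖ ≤ 7 / 24 * V / b ^ 3 * |z| ^ 3 := by
    intro z
    have hψ : (ψ z : ℂ) = ∏ i, ((Real.exp (-((z / b) ^ 2 * (∑ k, p i k * X i k ^ 2) / 2)) : ℝ) : ℂ) := by
      change ((Real.exp (-(V / b ^ 2 * z ^ 2 / 2)) : ℝ) : ℂ) = _
      rw [← Complex.ofReal_prod, ← Real.exp_sum]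
      congr 2
      rw [Finset.sum_neg_distrib, ← Finset.sum_div, ← Finset.mul_sum, ← hV]
      ring
    rw [hψ]
    refine (ls_prod_sub_prod _ _ _ ?_ ?_).trans ?_
    · intro i
      refine (norm_sum_le _ _).trans ?_
      rw [← (hp i).2]
      refine Finset.sum_le_sum fun k _ => ?_
      rw [norm_mul, Complex.norm_exp_I_mul_ofReal, mul_one, Complex.norm_real,
        Real.norm_of_nonneg ((hp i).1 k)]
    · intro i
      rw [Complex.norm_real, Real.norm_of_nonneg (Real.exp_pos _).le, Real.exp_le_one_iff]
      have := hvi i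
      have : 0 ≤ (z / b) ^ 2 * (∑ k, p i k * X i k ^ 2) / 2 := by positivity
      linarith
    · refine (Finset.sum_le_sum fun i _ =>
        ls_one_step (p i) (X i) (hp i) (h0 i) (hX i) (hv i) (z / b)).trans ?_
      rw [← Finset.mul_sum, ← hV, abs_div, abs_of_pos hb, div_pow]
      apply le_of_eq; ring
  have key : ‖∫ z, (φ (z / b) - (ψ z : ℂ)) ∂γ‖ ≤ 7 / 24 * V / b ^ 3 * (8 / 5) := by
    refine (norm_integral_le_of_norm_le (ls_gauss_third_int.const_mul _)
      (Filter.Eventually.of_forall hpt)).trans ?_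
    rw [integral_const_mul]
    exact mul_le_mul_of_nonneg_left ls_gauss_third (by positivity)
  have hψint' : Integrable (fun z => (ψ z : ℂ)) γ := hψint.ofReal
  rw [integral_sub hφint hψint', hI1, hI2, ← Complex.ofReal_sub, Complex.norm_real,
    Real.norm_eq_abs] at key
  refine key.trans (le_of_eq ?_)
  ring

/-! ### Part 2: the window lemma -/

lemma ls_total {n K : ℕ} (p : Fin n → Fin K → ℝ) (hp : ∀ i, IsProb (p i)) :
    ∑ y : Fin n → Fin K, ∏ i, p i (y i) = 1 := by
  have h := Finset.prod_univ_sum (fun _ : Fin n => (Finset.univ : Finset (Fin K))) p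
  rw [Fintype.piFinset_univ] at h
  rw [← h]
  exact Finset.prod_eq_one fun i _ => (hp i).2

lemma ls_cross {n K : ℕ} (p X : Fin n → Fin K → ℝ) (hp : ∀ i, IsProb (p i))
    (h0 : ∀ i, ∑ k, p i k * X i k = 0) (a b : Fin n) :
    ∑ y : Fin n → Fin K, (∏ i, p i (y i)) * (X a (y a) * X b (y b))
      = if a = b then ∑ k, p a k * X a k ^ 2 else 0 := by
  have h := Finset.prod_univ_sum (fun _ : Fin n => (Finset.univ : Finset (Fin K)))
    (fun i k => p i k * ((if i = a then X i k else 1) * (if i = b then X i k else 1)))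
  rw [Fintype.piFinset_univ] at h
  have e : ∀ y : Fin n → Fin K, (∏ i, p i (y i)) * (X a (y a) * X b (y b)) =
      ∏ i, (p i (y i) * ((if i = a then X i (y i) else 1) * (if i = b then X i (y i) else 1))) := by
    intro y
    rw [Finset.prod_mul_distrib, Finset.prod_mul_distrib, Finset.prod_ite_eq' Finset.univ a
      (fun i => X i (y i)), Finset.prod_ite_eq' Finset.univ b (fun i => X i (y i))]
    simp
  simp_rw [e]
  rw [← h]
  split_ifs with hab
  · subst hab
    rw [Finset.prod_eq_single a]
    · refine Finset.sum_congr rfl fun k _ => ?_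
      simp only [if_true]; ring
    · intro i _ hi
      simp [hi, (hp i).2]
    · simp
  · refine Finset.prod_eq_zero (Finset.mem_univ a) ?_
    simpa [hab] using h0 a

lemma ls_second_moment {n K : ℕ} (p X : Fin n → Fin K → ℝ) (hp : ∀ i, IsProb (p i))
    (h0 : ∀ i, ∑ k, p i k * X i k = 0) :
    ∑ y : Fin n → Fin K, (∏ i, p i (y i)) * (∑ i, X i (y i)) ^ 2
      = ∑ i, ∑ k, p i k * X i k ^ 2 := by
  have e : ∀ y : Fin n → Fin K, (∏ i, p i (y i)) * (∑ i, X i (y i)) ^ 2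
      = ∑ a, ∑ b, (∏ i, p i (y i)) * (X a (y a) * X b (y b)) := by
    intro y
    rw [sq, Finset.sum_mul_sum, Finset.mul_sum]
    refine Finset.sum_congr rfl fun a _ => ?_
    rw [Finset.mul_sum]
  simp_rw [e]
  rw [Finset.sum_comm]
  refine Finset.sum_congr rfl fun a _ => ?_
  rw [Finset.sum_comm]
  simp_rw [ls_cross p X hp h0]
  simp

lemma ls_lower {n K : ℕ} (p X : Fin n → Fin K → ℝ) (hp : ∀ i, IsProb (p i)) (a : ℝ)
    (f : ℝ → ℝ) (hf1 : ∀ w, f w ≤ 1) (hf2 : ∀ w, a < |w| → f w ≤ 0) :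
    ∑ y : Fin n → Fin K, (∏ i, p i (y i)) * f (∑ i, X i (y i)) ≤
    ∑ y : Fin n → Fin K, if |∑ i, X i (y i)| ≤ a then ∏ i, p i (y i) else 0 := by
  refine Finset.sum_le_sum fun y _ => ?_
  have h : 0 ≤ ∏ i, p i (y i) := Finset.prod_nonneg fun i _ => (hp i).1 _
  split_ifs with hy
  · exact mul_le_of_le_one_right h (hf1 _)
  · exact mul_nonpos_of_nonneg_of_nonpos h (hf2 _ (not_le.1 hy))

lemma ls_window_aux {n K : ℕ} (p X : Fin n → Fin K → ℝ) (hp : ∀ i, IsProb (p i))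
    (h0 : ∀ i, ∑ k, p i k * X i k = 0) (hX : ∀ i k, |X i k| ≤ 1)
    (hv : ∀ i, ∑ k, p i k * X i k ^ 2 ≤ 1 / 4) (u : ℝ) (hu : 1 ≤ u) (hun : u ^ 8 = n) :
    1 / (2 * u) ≤
    ∑ y : Fin n → Fin K, if |∑ i, X i (y i)| ≤ 2 * u ^ 3 then ∏ i, p i (y i) else 0 := by
  have hu0 : 0 < u := by linarith
  set V := ∑ i, ∑ k, p i k * X i k ^ 2 with hV
  have hV0 : 0 ≤ V := Finset.sum_nonneg fun i _ =>
    Finset.sum_nonneg fun k _ => mul_nonneg ((hp i).1 k) (sq_nonneg _)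
  have hVn : V ≤ u ^ 8 / 4 := by
    calc V ≤ ∑ _i : Fin n, (1 / 4 : ℝ) := Finset.sum_le_sum fun i _ => hv i
      _ = u ^ 8 / 4 := by rw [hun]; simp; ring
  rcases le_total u (7 / 2) with hsmall | hlarge
  · skip
    refine le_trans ?_ (ls_lower p X hp (2 * u ^ 3) (fun w => 1 - w ^ 2 / (4 * u ^ 6)) ?_ ?_)
    · have e : ∀ y : Fin n → Fin K, (∏ i, p i (y i)) * (1 - (∑ i, X i (y i)) ^ 2 / (4 * u ^ 6))
          = ∏ i, p i (y i) - (1 / (4 * u ^ 6)) * ((∏ i, p i (y i)) * (∑ i, X i (y i)) ^ 2) := by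
        intro y; ring
      simp_rw [e]
      rw [Finset.sum_sub_distrib, ← Finset.mul_sum, ls_total p hp, ls_second_moment p X hp h0, ← hV]
      have h1 : 1 / (4 * u ^ 6) * V ≤ u ^ 2 / 16 := by
        rw [div_mul_eq_mul_div, div_le_iff₀ (by positivity)]
        nlinarith
      have h2 : 1 / (2 * u) ≤ 1 - u ^ 2 / 16 := by
        rw [div_le_iff₀ (by positivity)]
        nlinarith
      linarith
    · intro w
      have : 0 ≤ w ^ 2 / (4 * u ^ 6) := by positivity
      linarith
    · intro w hw
      have h2 : (2 * u ^ 3) ^ 2 ≤ w ^ 2 := by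
        rw [← sq_abs w]; exact pow_le_pow_left₀ (by positivity) hw.le 2
      have : 1 ≤ w ^ 2 / (4 * u ^ 6) := by
        rw [le_div_iff₀ (by positivity)]; nlinarith
      linarith
  · skip
    set κ := Real.exp (-(3 / 2)) with hκ
    have hκ0 : 0 < κ := Real.exp_pos _
    have hκ1 : κ ≤ 1 / 4 := by
      have h1 : κ ^ 2 = (Real.exp 1 ^ 3)⁻¹ := by
        rw [hκ, ← Real.exp_nat_mul, ← Real.exp_nat_mul, ← Real.exp_neg]; norm_num
      have h2 : (16 : ℝ) ≤ Real.exp 1 ^ 3 := by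
        have := Real.exp_one_gt_d9
        have h3 : (2.7 : ℝ) ^ 3 ≤ Real.exp 1 ^ 3 :=
          pow_le_pow_left₀ (by norm_num) (by linarith) 3
        norm_num at h3 ⊢; linarith
      have h3 : (Real.exp 1 ^ 3)⁻¹ ≤ (16 : ℝ)⁻¹ := inv_anti₀ (by norm_num) h2
      rw [← h1] at h3
      nlinarith
    refine le_trans ?_ (ls_lower p X hp (2 * u ^ 3)
      (fun w => Real.exp (-(w ^ 2 / (2 * (u ^ 3) ^ 2)))
        - κ * Real.exp (-(w ^ 2 / (2 * (2 * u ^ 3) ^ 2)))) ?_ ?_)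
    · have e : ∀ y : Fin n → Fin K, (∏ i, p i (y i)) *
          (Real.exp (-((∑ i, X i (y i)) ^ 2 / (2 * (u ^ 3) ^ 2)))
            - κ * Real.exp (-((∑ i, X i (y i)) ^ 2 / (2 * (2 * u ^ 3) ^ 2))))
          = (∏ i, p i (y i)) * Real.exp (-((∑ i, X i (y i)) ^ 2 / (2 * (u ^ 3) ^ 2)))
            - κ * ((∏ i, p i (y i)) *
              Real.exp (-((∑ i, X i (y i)) ^ 2 / (2 * (2 * u ^ 3) ^ 2)))) := by
        intro y; ring
      simp_rw [e]
      rw [Finset.sum_sub_distrib, ← Finset.mul_sum]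
      have f1 := (abs_le.1 (ls_fourier p X hp h0 hX hv (u ^ 3) (by positivity))).1
      have f2 := (abs_le.1 (ls_fourier p X hp h0 hX hv (2 * u ^ 3) (by positivity))).2
      rw [← hV] at f1 f2
      set S1 := ∑ y : Fin n → Fin K, (∏ i, p i (y i)) *
        Real.exp (-((∑ i, X i (y i)) ^ 2 / (2 * (u ^ 3) ^ 2)))
      set S2 := ∑ y : Fin n → Fin K, (∏ i, p i (y i)) *
        Real.exp (-((∑ i, X i (y i)) ^ 2 / (2 * (2 * u ^ 3) ^ 2)))
      set r := V / (2 * u ^ 3) ^ 2 with hr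
      have hr0 : 0 ≤ r := by positivity
      have hr1 : r ≤ u ^ 2 / 16 := by
        rw [hr, div_le_iff₀ (by positivity)]; nlinarith
      have hs0 : 0 < Real.sqrt (1 + r) := Real.sqrt_pos.2 (by linarith)
      have g1 : (1 / 2) * (1 / Real.sqrt (1 + r)) ≤ 1 / Real.sqrt (1 + V / (u ^ 3) ^ 2) := by
        have : V / (u ^ 3) ^ 2 = 4 * r := by rw [hr]; field_simp; ring
        rw [this]
        have h4 : Real.sqrt (1 + 4 * r) ≤ 2 * Real.sqrt (1 + r) := by
          rw [Real.sqrt_le_left (by positivity), mul_pow, Real.sq_sqrt (by linarith)]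
          linarith
        have h5 : 0 < Real.sqrt (1 + 4 * r) := Real.sqrt_pos.2 (by linarith)
        have := one_div_le_one_div_of_le h5 h4
        refine le_trans (le_of_eq ?_) this
        field_simp
      have g2 : 13 / 5 / u ≤ 1 / Real.sqrt (1 + r) := by
        rw [div_le_div_iff₀ hu0 hs0]
        have : Real.sqrt (1 + r) ≤ u * (5 / 13) := by
          rw [Real.sqrt_le_left (by positivity)]
          nlinarith
        linarith
      have g3 : V / (u ^ 3) ^ 3 ≤ 1 / (4 * u) := by
        rw [div_le_div_iff₀ (by positivity) (by positivity)]
        nlinarith [mul_le_mul_of_nonneg_right hVn hu0.le]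
      have g4 : V / (2 * u ^ 3) ^ 3 ≤ 1 / (32 * u) := by
        have : V / (2 * u ^ 3) ^ 3 = V / (u ^ 3) ^ 3 / 8 := by field_simp; ring
        rw [this]
        have : 1 / (32 * u) = 1 / (4 * u) / 8 := by field_simp; ring
        rw [this]; linarith
      rw [mul_div_assoc] at f1 f2
      set T := 1 / Real.sqrt (1 + r)
      set i := 1 / u with hi
      have hi0 : 0 < i := by positivity
      have q1 : 1 / (2 * u) = i / 2 := by rw [hi]; field_simp
      have q2 : 13 / 5 / u = 13 / 5 * i := by rw [hi]; ring
      have q3 : 1 / (4 * u) = i / 4 := by rw [hi]; field_simp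
      have q4 : 1 / (32 * u) = i / 32 := by rw [hi]; field_simp
      rw [q1]; rw [q2] at g2; rw [q3] at g3; rw [q4] at g4
      have S2b : S2 ≤ T + 7 / 15 * (i / 32) := by linarith
      have hT : 0 ≤ T := by positivity
      have S2c : κ * S2 ≤ 1 / 4 * (T + 7 / 15 * (i / 32)) := by
        refine (mul_le_mul_of_nonneg_left S2b hκ0.le).trans ?_
        exact mul_le_mul_of_nonneg_right hκ1 (by positivity)
      linarith
    · intro w
      have h1 : Real.exp (-(w ^ 2 / (2 * (u ^ 3) ^ 2))) ≤ 1 := by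
        rw [Real.exp_le_one_iff]
        have : 0 ≤ w ^ 2 / (2 * (u ^ 3) ^ 2) := by positivity
        linarith
      have h2 : 0 ≤ κ * Real.exp (-(w ^ 2 / (2 * (2 * u ^ 3) ^ 2))) := by positivity
      linarith
    · intro w hw
      rw [hκ, ← Real.exp_add, sub_nonpos, Real.exp_le_exp]
      have h2 : (2 * u ^ 3) ^ 2 ≤ w ^ 2 := by
        rw [← sq_abs w]; exact pow_le_pow_left₀ (by positivity) hw.le 2
      have h3 : 1 ≤ w ^ 2 / (2 * u ^ 3) ^ 2 := by
        rw [le_div_iff₀ (by positivity)]; linarith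
      have h4 : w ^ 2 / (2 * (u ^ 3) ^ 2) = 2 * (w ^ 2 / (2 * u ^ 3) ^ 2) := by field_simp
      have h5 : w ^ 2 / (2 * (2 * u ^ 3) ^ 2) = 1 / 2 * (w ^ 2 / (2 * u ^ 3) ^ 2) := by
        field_simp
      rw [h4, h5]; linarith

/-- The window lemma in the form used: `c i k ∈ [0,M]`. -/
lemma ls_window {n K : ℕ} (hn : 1 ≤ n) (p c : Fin n → Fin K → ℝ) (hp : ∀ i, IsProb (p i))
    (M : ℝ) (hM : 0 < M) (hc : ∀ i k, 0 ≤ c i k ∧ c i k ≤ M) :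
    1 / (2 * (n : ℝ) ^ ((1 : ℝ) / 8)) ≤
    ∑ y : Fin n → Fin K,
      if |∑ i, c i (y i) - ∑ i, ∑ k, p i k * c i k| ≤ 2 * M * (n : ℝ) ^ ((3 : ℝ) / 8)
      then ∏ i, p i (y i) else 0 := by
  set u := (n : ℝ) ^ ((1 : ℝ) / 8) with hu
  have hn0 : (0 : ℝ) ≤ n := Nat.cast_nonneg n
  have hn1 : (1 : ℝ) ≤ n := by exact_mod_cast hn
  have hu1 : 1 ≤ u := Real.one_le_rpow hn1 (by norm_num)
  have hu8 : u ^ 8 = n := by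
    rw [hu, ← Real.rpow_natCast, ← Real.rpow_mul hn0]; norm_num
  have hu3 : (n : ℝ) ^ ((3 : ℝ) / 8) = u ^ 3 := by
    rw [hu, ← Real.rpow_natCast, ← Real.rpow_mul hn0]; norm_num
  let m : Fin n → ℝ := fun i => ∑ k, p i k * (c i k / M)
  let X : Fin n → Fin K → ℝ := fun i k => c i k / M - m i
  have hcM : ∀ i k, 0 ≤ c i k / M ∧ c i k / M ≤ 1 := fun i k =>
    ⟨div_nonneg (hc i k).1 hM.le, (div_le_one hM).2 (hc i k).2⟩
  have hm0 : ∀ i, 0 ≤ m i := fun i =>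
    Finset.sum_nonneg fun k _ => mul_nonneg ((hp i).1 k) (hcM i k).1
  have hm1 : ∀ i, m i ≤ 1 := fun i => by
    rw [← (hp i).2]
    exact Finset.sum_le_sum fun k _ => mul_le_of_le_one_right ((hp i).1 k) (hcM i k).2
  have h0 : ∀ i, ∑ k, p i k * X i k = 0 := by
    intro i
    simp only [X, mul_sub]
    rw [Finset.sum_sub_distrib, ← Finset.sum_mul, (hp i).2, one_mul, sub_self]
  have hX : ∀ i k, |X i k| ≤ 1 := by
    intro i k
    rw [abs_le]
    have := hcM i k
    have := hm0 i
    have := hm1 i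
    simp only [X]
    constructor <;> linarith
  have hv : ∀ i, ∑ k, p i k * X i k ^ 2 ≤ 1 / 4 := by
    intro i
    calc ∑ k, p i k * X i k ^ 2 ≤ ∑ k, p i k * (c i k / M * (1 - 2 * m i) + m i ^ 2) := by
          refine Finset.sum_le_sum fun k _ => mul_le_mul_of_nonneg_left ?_ ((hp i).1 k)
          simp only [X]
          have := hcM i k
          nlinarith
      _ = m i * (1 - 2 * m i) + m i ^ 2 := by
          simp only [mul_add, ← mul_assoc]
          rw [Finset.sum_add_distrib, ← Finset.sum_mul, ← Finset.sum_mul, (hp i).2, one_mul]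
      _ ≤ 1 / 4 := by nlinarith [sq_nonneg (m i - 1 / 2)]
  refine (ls_window_aux p X hp h0 hX hv u hu1 hu8).trans (le_of_eq ?_)
  refine Finset.sum_congr rfl fun y _ => ?_
  have e : ∑ i, c i (y i) - ∑ i, ∑ k, p i k * c i k = M * ∑ i, X i (y i) := by
    simp only [X, m]
    rw [Finset.sum_sub_distrib, mul_sub, Finset.mul_sum, Finset.mul_sum]
    congr 1
    · refine Finset.sum_congr rfl fun i _ => ?_
      field_simp
    · refine Finset.sum_congr rfl fun i _ => ?_
      rw [Finset.mul_sum]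
      refine Finset.sum_congr rfl fun k _ => ?_
      field_simp
  rw [e, abs_mul, abs_of_pos hM, hu3]
  have : (|∑ i, X i (y i)| ≤ 2 * u ^ 3) ↔ (M * |∑ i, X i (y i)| ≤ 2 * M * u ^ 3) := by
    rw [show 2 * M * u ^ 3 = M * (2 * u ^ 3) by ring, mul_le_mul_iff_right₀ hM]
  simp only [this]

/-! ### Part 3: information-theoretic facts -/

lemma ls_kl_term (a b : ℝ) (ha : 0 ≤ a) (hb : 0 ≤ b) (hab : b = 0 → a = 0) :
    0 ≤ a * Real.log (a / b) - a + b ∧ (a * Real.log (a / b) - a + b = 0 → a = b) := by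
  rcases eq_or_lt_of_le hb with h | h
  · have := hab h.symm
    subst this; subst h
    simp
  · have e : a * Real.log (a / b) - a + b = b * InformationTheory.klFun (a / b) := by
      unfold InformationTheory.klFun
      field_simp
      ring
    have h0 : 0 ≤ a / b := by positivity
    rw [e]
    refine ⟨mul_nonneg hb (InformationTheory.klFun_nonneg h0), fun h1 => ?_⟩
    rcases mul_eq_zero.1 h1 with h2 | h2
    · linarith
    · rw [InformationTheory.klFun_eq_zero_iff h0, div_eq_one_iff_eq h.ne'] at h2
      exact h2

lemma ls_kl {K : ℕ} (p q : Fin K → ℝ) (hp : IsProb p) (hq : IsProb q)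
    (hpq : ∀ k, q k = 0 → p k = 0) :
    0 ≤ ∑ k, p k * Real.log (p k / q k) ∧
      (∑ k, p k * Real.log (p k / q k) = 0 → ∀ k, p k = q k) := by
  have e : ∑ k, p k * Real.log (p k / q k)
      = ∑ k, (p k * Real.log (p k / q k) - p k + q k) := by
    rw [Finset.sum_add_distrib, Finset.sum_sub_distrib, hp.2, hq.2]; ring
  have ht := fun k => ls_kl_term (p k) (q k) (hp.1 k) (hq.1 k) (hpq k)
  rw [e]
  refine ⟨Finset.sum_nonneg fun k _ => (ht k).1, fun h k => ?_⟩
  rw [Finset.sum_eq_zero_iff_of_nonneg fun k _ => (ht k).1] at h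
  exact (ht k).2 (h k (Finset.mem_univ k))

lemma ls_out_prob {J K : ℕ} (t : Fin J → ℝ) (ht : IsProb t) (Q : Fin J → Fin K → ℝ)
    (hQ : IsCondProb Q) : IsProb (fun k => ∑ j, t j * Q j k) := by
  refine ⟨fun k => Finset.sum_nonneg fun j _ => mul_nonneg (ht.1 j) ((hQ j).1 k), ?_⟩
  rw [Finset.sum_comm, ← ht.2]
  refine Finset.sum_congr rfl fun j _ => ?_
  rw [← Finset.mul_sum, (hQ j).2, mul_one]

lemma ls_out_zero {J K : ℕ} (t : Fin J → ℝ) (ht : IsProb t) (Q : Fin J → Fin K → ℝ)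
    (hQ : IsCondProb Q) (j : Fin J) (hj : 0 < t j) (k : Fin K)
    (h : ∑ j, t j * Q j k = 0) : Q j k = 0 := by
  rw [Finset.sum_eq_zero_iff_of_nonneg
    fun j _ => mul_nonneg (ht.1 j) ((hQ j).1 k)] at h
  rcases mul_eq_zero.1 (h j (Finset.mem_univ j)) with h1 | h1
  · linarith
  · exact h1

lemma ls_I_nonneg {J K : ℕ} (t : Fin J → ℝ) (ht : IsProb t) (Q : Fin J → Fin K → ℝ)
    (hQ : IsCondProb Q) : 0 ≤ mutualInfo t Q := by
  unfold mutualInfo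
  refine Finset.sum_nonneg fun j _ => ?_
  simp_rw [mul_assoc]
  rw [← Finset.mul_sum]
  rcases eq_or_lt_of_le (ht.1 j) with h | h
  · rw [← h]; simp
  · refine mul_nonneg h.le ?_
    exact (ls_kl (Q j) _ (hQ j) (ls_out_prob t ht Q hQ) (ls_out_zero t ht Q hQ j h)).1

lemma ls_RD_le {J K : ℕ} (t : Fin J → ℝ) (ht : IsProb t) (ρ : Fin J → Fin K → ℝ) (d : ℝ)
    (Q : Fin J → Fin K → ℝ) (hQ : IsCondProb Q) (hd : avgDist t Q ρ ≤ d) :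
    RD t d ρ ≤ mutualInfo t Q := by
  refine csInf_le ⟨0, ?_⟩ ⟨Q, hQ, hd, rfl⟩
  rintro r ⟨Q', hQ', _, rfl⟩
  exact ls_I_nonneg t ht Q' hQ'

lemma ls_RD_nonneg {J K : ℕ} (t : Fin J → ℝ) (ht : IsProb t) (ρ : Fin J → Fin K → ℝ) (d : ℝ) :
    0 ≤ RD t d ρ := by
  refine Real.sInf_nonneg ?_
  rintro r ⟨Q', hQ', _, rfl⟩
  exact ls_I_nonneg t ht Q' hQ'

lemma ls_avg_nonneg {J K : ℕ} (t : Fin J → ℝ) (ht : IsProb t) (ρ : Fin J → Fin K → ℝ)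
    (hρ : ∀ j k, 0 ≤ ρ j k) (Q : Fin J → Fin K → ℝ) (hQ : IsCondProb Q) :
    0 ≤ avgDist t Q ρ :=
  Finset.sum_nonneg fun j _ => Finset.sum_nonneg fun k _ =>
    mul_nonneg (mul_nonneg (ht.1 j) ((hQ j).1 k)) (hρ j k)

lemma ls_lagr_min {J K : ℕ} (t : Fin J → ℝ) (ht : IsProb t) (ρ : Fin J → Fin K → ℝ)
    (hρ : ∀ j k, 0 ≤ ρ j k) (d : ℝ) (Q : Fin J → Fin K → ℝ) (lam : ℝ)
    (hlag : IsLagrange t d ρ Q lam) (Q' : Fin J → Fin K → ℝ) (hQ' : IsCondProb Q') :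
    RD t d ρ + lam * d ≤ mutualInfo t Q' + lam * avgDist t Q' ρ := by
  obtain ⟨_, _, _, hl0, _, hsub⟩ := hlag
  refine le_of_forall_pos_le_add fun δ hδ => ?_
  have hD := ls_avg_nonneg t ht ρ hρ Q' hQ'
  have hε : 0 < δ / (lam + 1) := by positivity
  have h1 := hsub (avgDist t Q' ρ + δ / (lam + 1)) (by linarith)
  have h2 := ls_RD_le t ht ρ (avgDist t Q' ρ + δ / (lam + 1)) Q' hQ' (by linarith)
  have h3 : lam * (δ / (lam + 1)) ≤ δ := by
    rw [mul_div_assoc', div_le_iff₀ (by linarith)]; nlinarith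
  nlinarith

/-- The zero-distortion deterministic channel has information at most `log c`. -/
lemma ls_RD_le_log {J K : ℕ} (t : Fin J → ℝ) (ht : IsProb t) (ρ : Fin J → Fin K → ℝ)
    (hz : ∀ j, ∃ k, ρ j k = 0) (hJ : 0 < J) (hK : 0 < K) (d : ℝ) (hd : 0 < d) :
    RD t d ρ ≤ min (Real.log J) (Real.log K) := by
  choose kk hkk using hz
  let Q : Fin J → Fin K → ℝ := fun j k => if k = kk j then 1 else 0
  have hQ : IsCondProb Q := by
    intro j
    refine ⟨fun k => ?_, ?_⟩
    · simp only [Q]; split_ifs <;> norm_num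
    · simp [Q]
  have hD : avgDist t Q ρ = 0 := by
    unfold avgDist
    refine Finset.sum_eq_zero fun j _ => Finset.sum_eq_zero fun k _ => ?_
    simp only [Q]
    split_ifs with h
    · rw [h, hkk]; simp
    · simp
  set q : Fin K → ℝ := fun k => ∑ j, t j * Q j k with hq
  have hqp : IsProb q := ls_out_prob t ht Q hQ
  have hqt : ∀ j, t j ≤ q (kk j) := by
    intro j
    have := Finset.single_le_sum (f := fun j' => t j' * Q j' (kk j))
      (fun j' _ => mul_nonneg (ht.1 j') ((hQ j').1 _)) (Finset.mem_univ j)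
    simpa [Q, hq] using this
  have hI : mutualInfo t Q = ∑ j, t j * Real.log (1 / q (kk j)) := by
    unfold mutualInfo
    refine Finset.sum_congr rfl fun j _ => ?_
    rw [Finset.sum_eq_single (kk j)]
    · simp [Q, hq]
    · intro k _ hk
      simp [Q, hk]
    · simp
  have hgen : ∀ c : ℝ, 0 < c → ∑ j, t j / q (kk j) ≤ c → mutualInfo t Q ≤ Real.log c := by
    intro c hc hsum
    rw [hI]
    have h1 : ∀ j ∈ Finset.univ, t j * Real.log (1 / q (kk j))
        ≤ t j * (Real.log c - 1) + (t j / q (kk j)) / c := by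
      intro j _
      rcases eq_or_lt_of_le (ht.1 j) with h | h
      · rw [← h]; simp
      · have hqj : 0 < q (kk j) := h.trans_le (hqt j)
        have h2 := Real.log_le_sub_one_of_pos (x := 1 / q (kk j) / c) (by positivity)
        rw [Real.log_div (by positivity) hc.ne'] at h2
        calc t j * Real.log (1 / q (kk j)) ≤ t j * (Real.log c - 1 + 1 / q (kk j) / c) :=
              mul_le_mul_of_nonneg_left (by linarith) h.le
          _ = _ := by ring
    refine (Finset.sum_le_sum h1).trans ?_
    rw [Finset.sum_add_distrib, ← Finset.sum_mul, ← Finset.sum_div, ht.2]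
    have : (∑ j, t j / q (kk j)) / c ≤ 1 := (div_le_one hc).2 hsum
    linarith
  refine (ls_RD_le t ht ρ d Q hQ (by rw [hD]; exact hd.le)).trans (le_min ?_ ?_)
  · refine hgen J (by exact_mod_cast hJ) ?_
    calc ∑ j, t j / q (kk j) ≤ ∑ _j : Fin J, (1 : ℝ) :=
          Finset.sum_le_sum fun j _ => div_le_one_of_le₀ (hqt j) (hqp.1 _)
      _ = J := by simp
  · refine hgen K (by exact_mod_cast hK) ?_
    have e : ∀ j, t j / q (kk j) = ∑ k, t j * Q j k / q k := by
      intro j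
      rw [Finset.sum_eq_single (kk j)]
      · simp [Q]
      · intro k _ hk
        simp [Q, hk]
      · simp
    simp_rw [e]
    rw [Finset.sum_comm]
    calc ∑ k, ∑ j, t j * Q j k / q k ≤ ∑ _k : Fin K, (1 : ℝ) := by
          refine Finset.sum_le_sum fun k _ => ?_
          rw [← Finset.sum_div]
          exact div_self_le_one _
      _ = K := by simp

lemma ls_lam_le {J K : ℕ} (t : Fin J → ℝ) (ht : IsProb t) (ρ : Fin J → Fin K → ℝ)
    (hz : ∀ j, ∃ k, ρ j k = 0) (hJ : 0 < J) (hK : 0 < K) (d : ℝ) (hd : 0 < d)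
    (Q : Fin J → Fin K → ℝ) (lam : ℝ) (hlag : IsLagrange t d ρ Q lam) :
    lam ≤ min (Real.log J) (Real.log K) / d := by
  obtain ⟨_, _, _, hl0, _, hsub⟩ := hlag
  rw [le_div_iff₀ hd]
  refine le_of_forall_pos_le_add fun δ hδ => ?_
  have hε : 0 < δ / (lam + 1) := by positivity
  have h1 := hsub (δ / (lam + 1)) hε
  have h2 := ls_RD_le_log t ht ρ hz hJ hK _ hε
  have h3 : lam * (δ / (lam + 1)) ≤ δ := by
    rw [mul_div_assoc', div_le_iff₀ (by linarith)]; nlinarith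
  have h4 := ls_RD_nonneg t ht ρ d
  nlinarith

/-- KKT conditions: the optimal channel is the exponential tilting of its output law. -/
lemma ls_kkt {J K : ℕ} (t : Fin J → ℝ) (ht : IsProb t) (ρ : Fin J → Fin K → ℝ)
    (hρ : ∀ j k, 0 ≤ ρ j k) (d : ℝ) (Q : Fin J → Fin K → ℝ) (lam : ℝ)
    (hlag : IsLagrange t d ρ Q lam) :
    ∃ Z : Fin J → ℝ, (∀ j, 0 < Z j) ∧
      (∀ j, 0 < t j → ∀ k, Q j k * Z j = (∑ j', t j' * Q j' k) * Real.exp (-(lam * ρ j k))) ∧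
      ∑ j, t j * Real.log (Z j) = -(RD t d ρ + lam * d) := by
  have hQ := hlag.1
  have hIQ := hlag.2.2.1
  have hslack := hlag.2.2.2.2.1
  set q : Fin K → ℝ := fun k => ∑ j, t j * Q j k with hq
  have hqp : IsProb q := ls_out_prob t ht Q hQ
  let Z : Fin J → ℝ := fun j => ∑ k, q k * Real.exp (-(lam * ρ j k))
  have hZ : ∀ j, 0 < Z j := by
    intro j
    have hex : ∃ k, 0 < q k := by
      by_contra! hcon
      have := Finset.sum_nonpos (s := Finset.univ) fun k _ => hcon k
      rw [hqp.2] at this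
      linarith
    obtain ⟨k, hk⟩ := hex
    exact Finset.sum_pos' (fun k _ => mul_nonneg (hqp.1 k) (Real.exp_pos _).le)
      ⟨k, Finset.mem_univ k, mul_pos hk (Real.exp_pos _)⟩
  let Q' : Fin J → Fin K → ℝ := fun j k => q k * Real.exp (-(lam * ρ j k)) / Z j
  have hQ' : IsCondProb Q' := by
    intro j
    refine ⟨fun k => div_nonneg (mul_nonneg (hqp.1 k) (Real.exp_pos _).le) (hZ j).le, ?_⟩
    simp only [Q']
    rw [← Finset.sum_div]
    exact div_self (hZ j).ne'
  set q' : Fin K → ℝ := fun k => ∑ j, t j * Q' j k with hq'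
  have hqp' : IsProb q' := ls_out_prob t ht Q' hQ'
  have hQ'0 : ∀ j k, q k = 0 → Q' j k = 0 := by
    intro j k h; simp only [Q', h]; simp
  have hq'0 : ∀ k, q k = 0 → q' k = 0 := by
    intro k h
    exact Finset.sum_eq_zero fun j _ => by rw [hQ'0 j k h, mul_zero]
  have h2 : ∑ j, ∑ k, t j * Q' j k * Real.log (Q' j k / q k) + lam * avgDist t Q' ρ
      = - ∑ j, t j * Real.log (Z j) := by
    unfold avgDist
    rw [Finset.mul_sum, ← Finset.sum_add_distrib, ← Finset.sum_neg_distrib]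
    refine Finset.sum_congr rfl fun j _ => ?_
    rw [Finset.mul_sum, ← Finset.sum_add_distrib]
    have : ∀ k, t j * Q' j k * Real.log (Q' j k / q k) + lam * (t j * Q' j k * ρ j k)
        = -(t j * Real.log (Z j)) * Q' j k := by
      intro k
      by_cases h : q k = 0
      · simp [hQ'0 j k h]
      · have : Q' j k / q k = Real.exp (-(lam * ρ j k)) / Z j := by
          simp only [Q']; field_simp
        rw [this, Real.log_div (Real.exp_pos _).ne' (hZ j).ne', Real.log_exp]
        ring
    simp_rw [this]
    rw [← Finset.mul_sum, (hQ' j).2, mul_one]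
  have h1 : mutualInfo t Q' ≤ ∑ j, ∑ k, t j * Q' j k * Real.log (Q' j k / q k) := by
    have e : ∑ j, ∑ k, t j * Q' j k * Real.log (Q' j k / q k) - mutualInfo t Q'
        = ∑ k, q' k * Real.log (q' k / q k) := by
      unfold mutualInfo
      rw [← Finset.sum_sub_distrib]
      simp_rw [← Finset.sum_sub_distrib]
      rw [Finset.sum_comm]
      refine Finset.sum_congr rfl fun k _ => ?_
      simp only [hq']
      rw [Finset.sum_mul]
      refine Finset.sum_congr rfl fun j _ => ?_
      by_cases h : t j * Q' j k = 0
      · rw [h]; simp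
      · have hQk : Q' j k ≠ 0 := right_ne_zero_of_mul h
        have hqk : q k ≠ 0 := fun h' => hQk (hQ'0 j k h')
        have hqk' : q' k ≠ 0 := by
          intro h'
          simp only [hq'] at h'
          rw [Finset.sum_eq_zero_iff_of_nonneg
            fun j _ => mul_nonneg (ht.1 j) ((hQ' j).1 k)] at h'
          exact h (h' j (Finset.mem_univ j))
        have hqk'' : ∑ j', t j' * Q' j' k ≠ 0 := hqk'
        rw [Real.log_div hQk hqk, Real.log_div hQk hqk'', Real.log_div hqk'' hqk]
        ring
    have := (ls_kl q' q hqp' hqp hq'0).1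
    linarith
  have h3 := ls_lagr_min t ht ρ hρ d Q lam hlag Q' hQ'
  have habs : ∀ j, 0 < t j → ∀ k, q k = 0 → Q j k = 0 := fun j hj k hk =>
    ls_out_zero t ht Q hQ j hj k hk
  have h4 : ∑ j, t j * ∑ k, Q j k * Real.log (Q j k / Q' j k)
      = mutualInfo t Q + lam * avgDist t Q ρ + ∑ j, t j * Real.log (Z j) := by
    unfold avgDist mutualInfo
    rw [Finset.mul_sum, ← Finset.sum_add_distrib, ← Finset.sum_add_distrib]
    refine Finset.sum_congr rfl fun j _ => ?_
    rcases eq_or_lt_of_le (ht.1 j) with h | h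
    · rw [← h]; simp
    · have e : t j * Real.log (Z j) = ∑ k, t j * Real.log (Z j) * Q j k := by
        rw [← Finset.mul_sum, (hQ j).2, mul_one]
      rw [e, Finset.mul_sum, Finset.mul_sum, ← Finset.sum_add_distrib, ← Finset.sum_add_distrib]
      refine Finset.sum_congr rfl fun k _ => ?_
      by_cases hQk : Q j k = 0
      · simp [hQk]
      · have hqk : q k ≠ 0 := fun h' => hQk (habs j h k h')
        have hqk2 : ∑ j', t j' * Q j' k ≠ 0 := hqk
        have e2 : Q j k / Q' j k = Q j k / q k / (Real.exp (-(lam * ρ j k)) / Z j) := by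
          have := (hZ j).ne'
          have := (Real.exp_pos (-(lam * ρ j k))).ne'
          simp only [Q']; field_simp
        have e3 : Q j k / ∑ j', t j' * Q j' k = Q j k / q k := rfl
        rw [e2, e3, Real.log_div (div_ne_zero hQk hqk)
          (div_ne_zero (Real.exp_pos _).ne' (hZ j).ne'),
          Real.log_div (Real.exp_pos _).ne' (hZ j).ne', Real.log_exp]
        ring
  have h5 : mutualInfo t Q + lam * avgDist t Q ρ = RD t d ρ + lam * d := by
    rw [hIQ]; linarith
  have hQQ0 : ∀ j, 0 < t j → ∀ k, Q' j k = 0 → Q j k = 0 := by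
    intro j hj k hk
    apply habs j hj k
    simp only [Q'] at hk
    rcases div_eq_zero_iff.1 hk with h | h
    · rcases mul_eq_zero.1 h with h | h
      · exact h
      · exact absurd h (Real.exp_pos _).ne'
    · exact absurd h (hZ j).ne'
  have hterm : ∀ j ∈ Finset.univ, 0 ≤ t j * ∑ k, Q j k * Real.log (Q j k / Q' j k) := by
    intro j _
    rcases eq_or_lt_of_le (ht.1 j) with h | h
    · rw [← h]; simp
    · exact mul_nonneg h.le (ls_kl (Q j) (Q' j) (hQ j) (hQ' j) (hQQ0 j h)).1
  have h6 : ∑ j, t j * ∑ k, Q j k * Real.log (Q j k / Q' j k) = 0 := by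
    refine le_antisymm ?_ (Finset.sum_nonneg hterm)
    rw [h4]; linarith
  refine ⟨Z, hZ, ?_, by linarith⟩
  intro j hj k
  rw [Finset.sum_eq_zero_iff_of_nonneg hterm] at h6
  have h7 : ∑ k, Q j k * Real.log (Q j k / Q' j k) = 0 := by
    rcases mul_eq_zero.1 (h6 j (Finset.mem_univ j)) with h | h
    · linarith
    · exact h
  have h8 := (ls_kl (Q j) (Q' j) (hQ j) (hQ' j) (hQQ0 j hj)).2 h7 k
  rw [h8]
  simp only [Q']
  rw [div_mul_cancel₀ _ (hZ j).ne']

lemma ls_type_sum {J n : ℕ} (hn : 0 < n) (x : Fin n → Fin J) (f : Fin J → ℝ) :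
    ∑ i, f (x i) = n * ∑ j, typeOf x j * f j := by
  have hn' : (n : ℝ) ≠ 0 := by exact_mod_cast hn.ne'
  rw [← Finset.sum_fiberwise Finset.univ x (fun i => f (x i)), Finset.mul_sum]
  refine Finset.sum_congr rfl fun j _ => ?_
  have : ∑ i with x i = j, f (x i) = ∑ i with x i = j, f j :=
    Finset.sum_congr rfl fun i hi => by rw [(Finset.mem_filter.1 hi).2]
  rw [this, Finset.sum_const, nsmul_eq_mul]
  unfold typeOf
  field_simp

lemma ls_type_prob {J n : ℕ} (hn : 0 < n) (x : Fin n → Fin J) : IsProb (typeOf x) := by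
  have hn' : (n : ℝ) ≠ 0 := by exact_mod_cast hn.ne'
  refine ⟨fun a => by unfold typeOf; positivity, ?_⟩
  have := ls_type_sum hn x (fun _ => 1)
  simp only [Finset.sum_const, Finset.card_univ, Fintype.card_fin, nsmul_eq_mul, mul_one] at this
  field_simp at this
  linarith

lemma ls_type_pos {J n : ℕ} (hn : 0 < n) (x : Fin n → Fin J) (i : Fin n) :
    0 < typeOf x (x i) := by
  unfold typeOf
  have : 0 < (Finset.univ.filter fun i' => x i' = x i).card :=
    Finset.card_pos.2 ⟨i, by simp⟩
  have h1 : (0 : ℝ) < (Finset.univ.filter fun i' => x i' = x i).card := by exact_mod_cast this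
  have h2 : (0 : ℝ) < n := by exact_mod_cast hn
  positivity

lemma ls_main {J K : ℕ} (ρmax : ℝ) (hρmax : 0 < ρmax) (d : ℝ)
    (n : ℕ) (hn : 10 ≤ n) (x : Fin n → Fin J)
    (ρ : Fin J → Fin K → ℝ) (hρ : IsDistMeasure ρmax ρ)
    (Qs : Fin J → Fin K → ℝ) (lam : ℝ)
    (hlag : IsLagrange (typeOf x) d ρ Qs lam) :
    Real.exp (-(n : ℝ) * RD (typeOf x) d ρ - 2 * ρmax * lam * (n : ℝ) ^ ((3 : ℝ) / 8)
          - (1 / 8) * Real.log n + Real.log (1 / 2)) ≤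
    ∑ y : Fin n → Fin K,
        if nDist ρ x y ≤ d + 2 * ρmax / (n : ℝ) ^ ((5 : ℝ) / 8)
        then ∏ i, (∑ j, typeOf x j * Qs j (y i)) else 0 := by
  have hn0 : 0 < n := by omega
  have hnR : (0 : ℝ) < n := by exact_mod_cast hn0
  have ht := ls_type_prob hn0 x
  obtain ⟨Z, hZ, hkkt, hsum⟩ := ls_kkt (typeOf x) ht ρ (fun j k => (hρ.1 j k).1) d Qs lam hlag
  have hQ := hlag.1
  have hDd := hlag.2.1
  have hl0 := hlag.2.2.2.1
  have hslack := hlag.2.2.2.2.1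
  have hqp := ls_out_prob (typeOf x) ht Qs hQ
  set D := avgDist (typeOf x) Qs ρ with hD
  set R := RD (typeOf x) d ρ with hR
  set a := (n : ℝ) ^ ((3 : ℝ) / 8) with ha
  have ha0 : 0 < a := Real.rpow_pos_of_pos hnR _
  have hmean : ∑ i, ∑ k, Qs (x i) k * ρ (x i) k = n * D := by
    rw [ls_type_sum hn0 x (fun j => ∑ k, Qs j k * ρ j k), hD]
    unfold avgDist
    congr 1
    refine Finset.sum_congr rfl fun j _ => ?_
    rw [Finset.mul_sum]
    exact Finset.sum_congr rfl fun k _ => by ring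
  have hlogZ : ∑ i, Real.log (Z (x i)) = -(n * (R + lam * d)) := by
    rw [ls_type_sum hn0 x (fun j => Real.log (Z j)), hsum]; ring
  have hwin := ls_window (by omega : 1 ≤ n) (fun i => Qs (x i)) (fun i => ρ (x i))
    (fun i => hQ (x i)) ρmax hρmax (fun i k => hρ.1 (x i) k)
  rw [hmean, ← ha] at hwin
  have hexp : Real.exp (-(n : ℝ) * R - 2 * ρmax * lam * a
      - (1 / 8) * Real.log n + Real.log (1 / 2))
      = Real.exp (-(n : ℝ) * R - 2 * ρmax * lam * a) * (1 / (2 * (n : ℝ) ^ ((1 : ℝ) / 8))) := by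
    rw [sub_add, Real.exp_sub _ ((1 / 8) * Real.log n - Real.log (1 / 2)),
      Real.exp_sub _ (Real.log (1 / 2)), Real.exp_log (by norm_num), Real.rpow_def_of_pos hnR,
      mul_comm (Real.log n)]
    field_simp
  rw [hexp]
  refine (mul_le_mul_of_nonneg_left hwin (Real.exp_pos _).le).trans ?_
  rw [Finset.mul_sum]
  refine Finset.sum_le_sum fun y _ => ?_
  have hq0 : 0 ≤ ∏ i, (∑ j, typeOf x j * Qs j (y i)) :=
    Finset.prod_nonneg fun i _ => hqp.1 (y i)
  by_cases hy : |∑ i, ρ (x i) (y i) - n * D| ≤ 2 * ρmax * a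
  · obtain ⟨hy1, hy2⟩ := abs_le.1 hy
    have hdist : nDist ρ x y ≤ d + 2 * ρmax / (n : ℝ) ^ ((5 : ℝ) / 8) := by
      have e : (n : ℝ) ^ ((5 : ℝ) / 8) * a = n := by
        rw [ha, ← Real.rpow_add hnR]; norm_num
      have h58 : 0 < (n : ℝ) ^ ((5 : ℝ) / 8) := Real.rpow_pos_of_pos hnR _
      have e2 : 2 * ρmax / (n : ℝ) ^ ((5 : ℝ) / 8) = 2 * ρmax * a / n := by
        rw [div_eq_div_iff h58.ne' hnR.ne']
        linear_combination (-(2 * ρmax)) * e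
      unfold nDist
      rw [e2, div_le_iff₀ hnR, add_mul, div_mul_cancel₀ _ hnR.ne']
      nlinarith
    rw [if_pos hy, if_pos hdist]
    have hprod : ∏ i, (∑ j, typeOf x j * Qs j (y i)) = (∏ i, Qs (x i) (y i)) *
        Real.exp (∑ i, Real.log (Z (x i)) + lam * ∑ i, ρ (x i) (y i)) := by
      rw [Finset.mul_sum, ← Finset.sum_add_distrib, Real.exp_sum, ← Finset.prod_mul_distrib]
      refine Finset.prod_congr rfl fun i _ => ?_
      have := hkkt (x i) (ls_type_pos hn0 x i) (y i)
      rw [Real.exp_add, Real.exp_log (hZ _), ← mul_assoc, this, mul_assoc, ← Real.exp_add]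
      simp
    rw [hprod, mul_comm]
    refine mul_le_mul_of_nonneg_left ?_ (Finset.prod_nonneg fun i _ => (hQ (x i)).1 _)
    rw [Real.exp_le_exp, hlogZ]
    have h1 : lam * (n * D - 2 * ρmax * a) ≤ lam * ∑ i, ρ (x i) (y i) :=
      mul_le_mul_of_nonneg_left (by linarith) hl0
    have h2 : lam * (n * D) = n * (lam * d) := by
      have : lam * D = lam * d := by linarith
      calc lam * (n * D) = n * (lam * D) := by ring
        _ = _ := by rw [this]
    nlinarith
  · rw [if_neg hy, mul_zero]
    split_ifs
    · exact hq0
    · exact le_refl 0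

/-- Lemma 12: fix `d > 0`. For every `n ≥ 10`, every `n`-type `t`
(the type of some `x^n`), every `ρ ∈ D` and every `x^n ∈ T_A^n(t)`: if `Y^n` is i.i.d.
from the optimal output distribution `Q^{t,d,ρ}`, then
`P(ρ_n(x^n,Y^n) ≤ d + 2ρmax/n^{5/8}) ≥ exp(−nR(t,d,ρ) − 2ρmax λ* n^{3/8} − (1/8)ln n + ln(1/2))`;
moreover `λ* ≤ min(ln J, ln K)/d`, so the ratio of this probability to `e^{−nR(t,d,ρ)}`
is at least `exp(−(2ρmax min(ln J, ln K)/d) n^{3/8} − (1/8)ln n + ln(1/2))`, uniformly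
over `t`, `ρ` and `x^n`. -/
theorem lucky_strike_final (J K : ℕ) (hJ : 0 < J) (hK : 0 < K)
    (ρmax : ℝ) (hρmax : 0 < ρmax) (d : ℝ) (hd : 0 < d)
    (n : ℕ) (hn : 10 ≤ n) (x : Fin n → Fin J)
    (ρ : Fin J → Fin K → ℝ) (hρ : IsDistMeasure ρmax ρ)
    (Qs : Fin J → Fin K → ℝ) (lam : ℝ)
    (hlag : IsLagrange (typeOf x) d ρ Qs lam) :
    lam ≤ min (Real.log J) (Real.log K) / d ∧
    (∑ y : Fin n → Fin K,
        if nDist ρ x y ≤ d + 2 * ρmax / (n : ℝ) ^ ((5 : ℝ) / 8)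
        then ∏ i, (∑ j, typeOf x j * Qs j (y i)) else 0)
      ≥ Real.exp (-(n : ℝ) * RD (typeOf x) d ρ - 2 * ρmax * lam * (n : ℝ) ^ ((3 : ℝ) / 8)
          - (1 / 8) * Real.log n + Real.log (1 / 2)) ∧
    (∑ y : Fin n → Fin K,
        if nDist ρ x y ≤ d + 2 * ρmax / (n : ℝ) ^ ((5 : ℝ) / 8)
        then ∏ i, (∑ j, typeOf x j * Qs j (y i)) else 0)
      ≥ Real.exp (-(n : ℝ) * RD (typeOf x) d ρ) *
        Real.exp (-(2 * ρmax * min (Real.log J) (Real.log K) / d) * (n : ℝ) ^ ((3 : ℝ) / 8)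
          - (1 / 8) * Real.log n + Real.log (1 / 2)) := by
  have hn0 : 0 < n := by omega
  have ht := ls_type_prob hn0 x
  have h1 := ls_lam_le (typeOf x) ht ρ hρ.2 hJ hK d hd Qs lam hlag
  have h2 := ls_main ρmax hρmax d n hn x ρ hρ Qs lam hlag
  refine ⟨h1, h2, ?_⟩
  refine le_trans ?_ h2
  rw [← Real.exp_add, Real.exp_le_exp]
  have ha : 0 ≤ 2 * ρmax * (n : ℝ) ^ ((3 : ℝ) / 8) := by positivity
  have h3 := mul_le_mul_of_nonneg_left h1 ha
  have e : 2 * ρmax * min (Real.log J) (Real.log K) / d * (n : ℝ) ^ ((3 : ℝ) / 8)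
      = 2 * ρmax * (n : ℝ) ^ ((3 : ℝ) / 8) * (min (Real.log J) (Real.log K) / d) := by ring
  linarith
end
end

section
/- Fix ρ_max = 3, d = 1, A = {0,1} and B = {0,1,2}. For every even positive integer n and every ε > 0, there exist a source sequence x^n ∈ A^n and a distortion measure ρ : A×B → [0,3] (bounded by ρ_max and with max_j min_k ρ(j,k) = 0) such that for any optimal output distribution Q^{t,d,ρ} (where t is the type of x^n), if Y^n is i.i.d. Q^{t,d,ρ} then P( ρ_n(x^n, Y^n) ≤ d ) / e^{−n·R(t,d,ρ)} ≤ ε. In other words, no nonvanishing uniform lower bound on P(ρ_n(x^n,Y^n) ≤ d)·e^{n R(t,d,ρ)} over all sequences and distortion measures is possible without distortion slack. -/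
open Filter MeasureTheory
open scoped BigOperators

noncomputable section

variable {A B : Type*}

lemma term_bound (P q f : ℝ) (hP : 0 ≤ P) (hq : 0 ≤ q) (hPq : P ≤ 2 * q) (hf : 0 < f) :
    P * (2 - 1 / f) - q * f ≤ P * Real.log (P / q) := by
  rcases hP.eq_or_lt with h | h
  · subst h
    simp
    positivity
  · have hq' : 0 < q := by linarith
    have h1 : 1 - 1 / f ≤ Real.log f := by
      have := Real.one_sub_inv_le_log_of_pos hf
      simpa using this
    have h2 : 1 - (P / (q * f))⁻¹ ≤ Real.log (P / (q * f)) :=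
      Real.one_sub_inv_le_log_of_pos (by positivity)
    have h3 : Real.log (P / q) = Real.log (P / (q * f)) + Real.log f := by
      rw [← Real.log_mul (by positivity) (by positivity)]
      congr 1
      field_simp
    rw [h3]
    have h4 : P * (1 - (P / (q * f))⁻¹) = P - q * f := by
      field_simp
    have h5 := mul_le_mul_of_nonneg_left h1 hP
    have h6 := mul_le_mul_of_nonneg_left h2 hP
    have h7 : P * (2 - 1 / f) = P + P * (1 - 1 / f) := by ring
    rw [h7, mul_add]
    linarith

/-- The distortion measure. -/
def rhoD (δ : ℝ) : Fin 2 → Fin 3 → ℝ := ![![0, 3, 1 + δ], ![3, 0, 1 + δ]]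

lemma info_lower (δ : ℝ) (h0 : 0 < δ) (h1 : δ ≤ 1 / 10) (t : Fin 2 → ℝ) (ht : ∀ a, t a = 1 / 2)
    (Q : Fin 2 → Fin 3 → ℝ) (hQ : IsCondProb Q) (hd : avgDist t Q (rhoD δ) ≤ 1) :
    1 - (Q 0 2 + Q 1 2) / 2 ≤ 64 * mutualInfo t Q := by
  have a0 := hQ 0
  have a1 := hQ 1
  obtain ⟨p0, s0⟩ := a0
  obtain ⟨p1, s1⟩ := a1
  simp only [Fin.sum_univ_three] at s0 s1
  simp only [avgDist, rhoD, Fin.sum_univ_two, Fin.sum_univ_three, ht] at hd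
  simp at hd
  have b00 := p0 0
  have b01 := p0 1
  have b02 := p0 2
  have b10 := p1 0
  have b11 := p1 1
  have b12 := p1 2
  simp only [mutualInfo, Fin.sum_univ_two, Fin.sum_univ_three, ht]
  have e00 := term_bound (Q 0 0) (1/2 * Q 0 0 + 1/2 * Q 1 0) (10/9) b00 (by linarith) (by linarith) (by norm_num)
  have e01 := term_bound (Q 0 1) (1/2 * Q 0 1 + 1/2 * Q 1 1) (8/9) b01 (by linarith) (by linarith) (by norm_num)
  have e02 := term_bound (Q 0 2) (1/2 * Q 0 2 + 1/2 * Q 1 2) 1 b02 (by linarith) (by linarith) (by norm_num)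
  have e10 := term_bound (Q 1 0) (1/2 * Q 0 0 + 1/2 * Q 1 0) (8/9) b10 (by linarith) (by linarith) (by norm_num)
  have e11 := term_bound (Q 1 1) (1/2 * Q 0 1 + 1/2 * Q 1 1) (10/9) b11 (by linarith) (by linarith) (by norm_num)
  have e12 := term_bound (Q 1 2) (1/2 * Q 0 2 + 1/2 * Q 1 2) 1 b12 (by linarith) (by linarith) (by norm_num)
  have key : 19 * (Q 0 1 + Q 1 0) ≤ 11 * (Q 0 0 + Q 1 1) := by
    have : δ * (Q 0 0 + Q 0 1 + Q 1 0 + Q 1 1) ≤ 1/10 * (Q 0 0 + Q 0 1 + Q 1 0 + Q 1 1) :=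
      mul_le_mul_of_nonneg_right h1 (by linarith)
    have e2 : Q 0 2 = 1 - Q 0 0 - Q 0 1 := by linarith
    have e3 : Q 1 2 = 1 - Q 1 0 - Q 1 1 := by linarith
    rw [e2, e3] at hd
    nlinarith
  norm_num at e00 e01 e02 e10 e11 e12 ⊢
  linarith

lemma RD_upper (δ : ℝ) (h0 : 0 < δ) (h1 : δ ≤ 1 / 10) (t : Fin 2 → ℝ) (ht : ∀ a, t a = 1 / 2) :
    RD t 1 (rhoD δ) ≤ δ := by
  set η := δ / (1 + δ) with hη
  have hη0 : 0 < η := by positivity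
  have hη1 : η * (1 + δ) = δ := by rw [hη]; field_simp
  have hη2 : η ≤ δ := by nlinarith
  let Q : Fin 2 → Fin 3 → ℝ := ![![η, 0, 1 - η], ![0, η, 1 - η]]
  have hle : RD t 1 (rhoD δ) ≤ mutualInfo t Q := by
    apply csInf_le
    · refine ⟨0, ?_⟩
      rintro r ⟨Q', hQ', hd, rfl⟩
      have := info_lower δ h0 h1 t ht Q' hQ' hd
      have a0 := hQ' 0
      have a1 := hQ' 1
      obtain ⟨p0, s0⟩ := a0
      obtain ⟨p1, s1⟩ := a1
      simp only [Fin.sum_univ_three] at s0 s1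
      linarith [p0 0, p0 1, p1 0, p1 1]
    · refine ⟨Q, ?_, ?_, rfl⟩
      · intro j
        fin_cases j
        · refine ⟨fun k => ?_, ?_⟩
          · fin_cases k <;> simp [Q] <;> linarith
          · simp [Q, Fin.sum_univ_three]
        · refine ⟨fun k => ?_, ?_⟩
          · fin_cases k <;> simp [Q] <;> linarith
          · simp [Q, Fin.sum_univ_three]
      · simp [avgDist, rhoD, Fin.sum_univ_two, Fin.sum_univ_three, ht, Q]
        linarith
  have hI : mutualInfo t Q = η * Real.log 2 := by
    have e1 : 1/2 * (1 - η) + 1/2 * (1 - η) = 1 - η := by ring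
    have e2 : (1 - η) / (1 - η) = 1 := div_self (by linarith)
    have e3 : η / (1/2 * η) = 2 := by field_simp
    simp only [mutualInfo, Fin.sum_univ_two, Fin.sum_univ_three, ht, Q]
    simp [-one_div, e1, e2, e3]
    ring
  have hl : Real.log 2 ≤ 1 := by
    have := Real.log_two_lt_d9
    linarith
  rw [hI] at hle
  nlinarith

lemma prob_bound (n : ℕ) (q : Fin 3 → ℝ) (hq : ∀ k, 0 ≤ q k) (hs : ∑ k, q k = 1)
    (S : (Fin n → Fin 3) → Prop) [DecidablePred S] (hS : ¬ S (fun _ => 2)) :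
    (∑ y : Fin n → Fin 3, if S y then ∏ i, q (y i) else 0) ≤ n * (1 - q 2) := by
  have hall : ∑ y : Fin n → Fin 3, ∏ i, q (y i) = 1 := by
    have := Finset.prod_univ_sum (fun _ : Fin n => (Finset.univ : Finset (Fin 3))) (fun _ k => q k)
    rw [hs] at this
    simpa using this.symm
  have h1 : (∑ y : Fin n → Fin 3, if S y then ∏ i, q (y i) else 0) ≤
      ∑ y : Fin n → Fin 3, ((∏ i, q (y i)) - if y = (fun _ => 2) then q 2 ^ n else 0) := by
    apply Finset.sum_le_sum
    intro y _
    by_cases hy : y = fun _ => 2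
    · subst hy
      simp [hS]
    · have : 0 ≤ ∏ i, q (y i) := Finset.prod_nonneg fun i _ => hq _
      rw [if_neg hy]
      split_ifs <;> simp [this]
  rw [Finset.sum_sub_distrib, hall] at h1
  simp only [Finset.sum_ite_eq', Finset.mem_univ, if_true] at h1
  have h2 := one_add_mul_le_pow (a := q 2 - 1) (by linarith [hq 2]) n
  have h3 : (1 + (q 2 - 1)) = q 2 := by ring
  rw [h3] at h2
  linarith

lemma exists_half (n : ℕ) (hn : 0 < n) (heven : Even n) :
    ∃ x : Fin n → Fin 2, ∀ a, typeOf x a = 1 / 2 := by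
  obtain ⟨m, rfl⟩ := heven
  have hm : (0 : ℝ) < m := by exact_mod_cast (by omega : 0 < m)
  refine ⟨Fin.append (fun _ : Fin m => 0) (fun _ : Fin m => 1), fun a => ?_⟩
  have : (Finset.univ.filter fun i : Fin (m + m) =>
      Fin.append (fun _ : Fin m => (0 : Fin 2)) (fun _ : Fin m => 1) i = a).card = m := by
    rw [Finset.card_filter, Fin.sum_univ_add]
    simp only [Fin.append_left, Fin.append_right]
    fin_cases a <;> simp
  simp only [typeOf, this]
  push_cast
  field_simp
  norm_num

/-- Proposition 2: with `ρmax = 3`, `d = 1`, `A = {0,1}`,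
`B = {0,1,2}`: for every even positive `n` and every `ε > 0` there exist a sequence
`x^n` and a distortion measure `ρ` (valued in `[0,3]`, with a zero in every row) such
that for any optimal output distribution `Q^{t,d,ρ}` (induced by any minimizer `Q*` of
the rate-distortion problem for the type `t` of `x^n`), if `Y^n` is i.i.d. `Q^{t,d,ρ}`
then `P(ρ_n(x^n,Y^n) ≤ d) / e^{−nR(t,d,ρ)} ≤ ε`. -/
theorem no_uniform_lower_bound (n : ℕ) (hn : 0 < n) (heven : Even n)
    (ε : ℝ) (hε : 0 < ε) :
    ∃ (x : Fin n → Fin 2) (ρ : Fin 2 → Fin 3 → ℝ),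
      IsDistMeasure 3 ρ ∧
      ∀ Qs : Fin 2 → Fin 3 → ℝ, IsCondProb Qs →
        avgDist (typeOf x) Qs ρ ≤ 1 →
        mutualInfo (typeOf x) Qs = RD (typeOf x) 1 ρ →
        (∑ y : Fin n → Fin 3,
            if nDist ρ x y ≤ 1
            then ∏ i, (∑ j, typeOf x j * Qs j (y i)) else 0)
          ≤ ε * Real.exp (-(n : ℝ) * RD (typeOf x) 1 ρ) := by
  obtain ⟨x, hx⟩ := exists_half n hn heven
  have hn' : (0 : ℝ) < n := by exact_mod_cast hn
  obtain ⟨δ, h0, h1, h2, h3⟩ : ∃ δ : ℝ, 0 < δ ∧ δ ≤ 1 / 10 ∧ n * δ ≤ 1 / 2 ∧ n * δ ≤ ε / 128 := by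
    refine ⟨min (1 / 10) (min (1 / 2 / n) (ε / 128 / n)), by positivity, min_le_left _ _, ?_, ?_⟩
    · rw [mul_comm, ← le_div_iff₀ hn']
      exact (min_le_right _ _).trans (min_le_left _ _)
    · rw [mul_comm, ← le_div_iff₀ hn']
      exact (min_le_right _ _).trans (min_le_right _ _)
  refine ⟨x, rhoD δ, ⟨?_, ?_⟩, ?_⟩
  · intro j k
    fin_cases j <;> fin_cases k <;> simp [rhoD] <;> constructor <;> linarith
  · intro j
    fin_cases j
    · exact ⟨0, by simp [rhoD]⟩
    · exact ⟨1, by simp [rhoD]⟩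
  intro Qs hQ hd hI
  have hR := RD_upper δ h0 h1 (typeOf x) hx
  have hw := info_lower δ h0 h1 (typeOf x) hx Qs hQ hd
  rw [hI] at hw
  have a0 := hQ 0
  have a1 := hQ 1
  obtain ⟨p0, s0⟩ := a0
  obtain ⟨p1, s1⟩ := a1
  simp only [Fin.sum_univ_three] at s0 s1
  have hP := prob_bound n (fun k => ∑ j, typeOf x j * Qs j k)
    (fun k => by
      simp only [Fin.sum_univ_two, hx]
      linarith [p0 k, p1 k])
    (by
      simp only [Fin.sum_univ_two, Fin.sum_univ_three, hx]
      linarith)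
    (fun y => nDist (rhoD δ) x y ≤ 1)
    (by
      have : ∀ j, rhoD δ j 2 = 1 + δ := by
        intro j
        fin_cases j <;> simp [rhoD]
      simp only [nDist, this]
      simp
      rw [lt_div_iff₀ hn']
      have := mul_pos hn' h0
      linarith)
  have hexp : 1 / 2 ≤ Real.exp (-(n : ℝ) * RD (typeOf x) 1 (rhoD δ)) := by
    have e1 := Real.add_one_le_exp (-(n : ℝ) * RD (typeOf x) 1 (rhoD δ))
    have e2 := mul_le_mul_of_nonneg_left hR hn'.le
    linarith
  refine hP.trans ?_
  have e3 : (n : ℝ) * (1 - ∑ j, typeOf x j * Qs j 2) ≤ n * (64 * δ) := by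
    apply mul_le_mul_of_nonneg_left _ hn'.le
    simp only [Fin.sum_univ_two, hx]
    linarith
  have e4 := mul_le_mul_of_nonneg_left hexp hε.le
  linarith
end
end
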